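/- arXiv:2110.10856 — 3 statements merged into one kernel-verified Lean document; each statement's English description precedes it below -/
import Mathlib

section
/- Let 0 < k < n and let V be a k-dimensional linear subspace of ℝ^n, with orthogonal complement V^⊥ (an (n−k)-dimensional subspace). The following are equivalent: (a) V is totally nonnegative, i.e. V ∈ Gr≥0_{k,n}; (b) var(v) ≤ k−1 for all v ∈ V; (c) var̄(w) ≥ k for all nonzero w ∈ V^⊥. -/
noncomputable section

/-- The Pluecker coordinate of the full-rank `k x n` matrix `C` on the column set `S`
(the minor on the columns in `S`, taken in increasing order). -/
def pluck {k n : ℕ} (C : Matrix (Fin k) (Fin n) ℝ) (S : Finset (Fin n))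
    (h : S.card = k) : ℝ :=
  (C.submatrix id (fun t => ((S.orderIsoOfFin h) t).val)).det

/-- `signChanges v` is `var(v)`: the number of sign changes in the sequence
`v 0, ..., v (n-1)`, ignoring zero entries. -/
def signChanges {n : ℕ} (v : Fin n → ℝ) : ℕ :=
  sSup {m | ∃ f : Fin (m + 1) → Fin n, StrictMono f ∧
    ∀ j : Fin m, v (f j.castSucc) * v (f j.succ) < 0}

/-- `varBar v` is `var-bar(v)`: the maximum of `var(w)` over all `w` agreeing
with `v` on the nonzero entries of `v`. -/
def varBar {n : ℕ} (v : Fin n → ℝ) : ℕ :=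
  sSup {m | ∃ w : Fin n → ℝ, (∀ i, v i ≠ 0 → w i = v i) ∧ signChanges w = m}

/-- `V` is a totally nonnegative point of the Grassmannian: up to a global
sign (absorbed into the choice of representative matrix), all Pluecker
coordinates of `V` are nonnegative. -/
def TotNonneg (k : ℕ) {n : ℕ} (V : Submodule ℝ (Fin n → ℝ)) : Prop :=
  ∃ C : Matrix (Fin k) (Fin n) ℝ,
    LinearIndependent ℝ (fun i => C i) ∧
    Submodule.span ℝ (Set.range (fun i => C i)) = V ∧
    ∀ (S : Finset (Fin n)) (h : S.card = k), 0 ≤ pluck C S h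


/-- The number of elements of `S` that are smaller than `i`. -/
def below {n : ℕ} (S : Finset (Fin n)) (i : Fin n) : ℕ := (S.filter (· < i)).card

/-- The entries of `v` on `S` are nonzero with alternating signs, `σ` giving the first sign. -/
def Alternates {n : ℕ} (v : Fin n → ℝ) (S : Finset (Fin n)) (σ : ℝ) : Prop :=
  ∀ i ∈ S, 0 < σ * (-1) ^ below S i * v i

/-- The nonzero entries of `v` on `S` are compatible with an alternating sign pattern on `S`. -/
def WeaklyAlternates {n : ℕ} (v : Fin n → ℝ) (S : Finset (Fin n)) (σ : ℝ) : Prop :=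
  ∀ i ∈ S, 0 ≤ σ * (-1) ^ below S i * v i

lemma below_image {m n : ℕ} {f : Fin m → Fin n} (hf : StrictMono f) (j : Fin m) :
    below (Finset.univ.image f) (f j) = j := by
  have : (Finset.univ.image f).filter (· < f j) = (Finset.Iio j).image f := by
    ext x
    simp only [Finset.mem_filter, Finset.mem_image, Finset.mem_univ, true_and, Finset.mem_Iio]
    constructor
    · rintro ⟨⟨a, rfl⟩, h⟩
      exact ⟨a, hf.lt_iff_lt.1 h, rfl⟩
    · rintro ⟨a, h, rfl⟩
      exact ⟨⟨a, rfl⟩, hf h⟩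
  rw [below, this, Finset.card_image_of_injective _ hf.injective, Fin.card_Iio]

lemma image_orderEmbOfFin {n m : ℕ} {S : Finset (Fin n)} (h : S.card = m) :
    Finset.univ.image (S.orderEmbOfFin h) = S := by
  ext x
  simp

lemma below_orderEmbOfFin {n m : ℕ} {S : Finset (Fin n)} (h : S.card = m) (j : Fin m) :
    below S (S.orderEmbOfFin h j) = j := by
  have := below_image (S.orderEmbOfFin h).strictMono j
  rwa [image_orderEmbOfFin] at this

lemma exists_initial {n m : ℕ} {S : Finset (Fin n)} (h : m ≤ S.card) :
    ∃ T ⊆ S, T.card = m ∧ ∀ i ∈ T, below T i = below S i := by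
  have hf : StrictMono (S.orderEmbOfFin rfl ∘ Fin.castLE h) :=
    (S.orderEmbOfFin rfl).strictMono.comp (Fin.strictMono_castLE h)
  refine ⟨Finset.univ.image (S.orderEmbOfFin rfl ∘ Fin.castLE h), ?_, ?_, ?_⟩
  · intro x hx
    obtain ⟨a, -, rfl⟩ := Finset.mem_image.1 hx
    exact Finset.orderEmbOfFin_mem _ _ _
  · rw [Finset.card_image_of_injective _ hf.injective, Finset.card_univ, Fintype.card_fin]
  · intro x hx
    obtain ⟨a, -, rfl⟩ := Finset.mem_image.1 hx
    rw [below_image hf, Function.comp_apply, below_orderEmbOfFin]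
    rfl

lemma exists_alternates_iff {n m : ℕ} (hm : 0 < m) (v : Fin n → ℝ) :
    (∃ f : Fin (m + 1) → Fin n, StrictMono f ∧
      ∀ j : Fin m, v (f j.castSucc) * v (f j.succ) < 0) ↔
    ∃ S : Finset (Fin n), S.card = m + 1 ∧ ∃ σ, Alternates v S σ := by
  constructor
  · rintro ⟨f, hf, h⟩
    refine ⟨Finset.univ.image f, ?_, v (f 0), ?_⟩
    · rw [Finset.card_image_of_injective _ hf.injective, Finset.card_univ, Fintype.card_fin]
    intro x hx
    obtain ⟨j, -, rfl⟩ := Finset.mem_image.1 hx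
    rw [below_image hf]
    induction j using Fin.induction with
    | zero =>
      have h0 : v (f 0) ≠ 0 := by
        intro h0
        have := h ⟨0, hm⟩
        rw [show (⟨0, hm⟩ : Fin m).castSucc = 0 from rfl, h0] at this
        simp at this
      simpa using mul_self_pos.2 h0
    | succ j ih =>
      have h1 := ih (Finset.mem_image_of_mem _ (Finset.mem_univ _))
      have h2 := mul_pos h1 (neg_pos.2 (h j))
      rw [Fin.val_castSucc] at h2
      rw [Fin.val_succ, pow_succ]
      refine pos_of_mul_pos_left (b := v (f j.castSucc) ^ 2) ?_ (sq_nonneg _)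
      linarith
  · rintro ⟨S, hS, σ, h⟩
    refine ⟨S.orderEmbOfFin hS, (S.orderEmbOfFin hS).strictMono, fun j => ?_⟩
    have h1 := h _ (Finset.orderEmbOfFin_mem S hS j.castSucc)
    have h2 := h _ (Finset.orderEmbOfFin_mem S hS j.succ)
    rw [below_orderEmbOfFin] at h1 h2
    have h3 := mul_pos h1 h2
    rw [Fin.val_succ, Fin.val_castSucc, pow_succ] at h3
    by_contra! h4
    have h5 : ((-1 : ℝ) ^ (j : ℕ)) * (-1) ^ (j : ℕ) = 1 := by
      rw [← mul_pow]; simp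
    have h6 : σ * (-1) ^ (j : ℕ) * v (S.orderEmbOfFin hS j.castSucc) *
        (σ * ((-1) ^ (j : ℕ) * -1) * v (S.orderEmbOfFin hS j.succ)) =
        - (σ ^ 2 * (v (S.orderEmbOfFin hS j.castSucc) * v (S.orderEmbOfFin hS j.succ))) := by
      linear_combination (- σ ^ 2 * v (S.orderEmbOfFin hS j.castSucc) *
        v (S.orderEmbOfFin hS j.succ)) * h5
    rw [h6] at h3
    linarith [mul_nonneg (sq_nonneg σ) h4]

lemma le_of_mem_signChanges {n m : ℕ} {v : Fin n → ℝ}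
    (h : ∃ f : Fin (m + 1) → Fin n, StrictMono f ∧
      ∀ j : Fin m, v (f j.castSucc) * v (f j.succ) < 0) : m ≤ n := by
  obtain ⟨f, hf, -⟩ := h
  have := Fintype.card_le_of_injective f hf.injective
  simp only [Fintype.card_fin] at this
  omega

lemma le_signChanges_iff {n m : ℕ} (hm : 0 < m) (v : Fin n → ℝ) :
    m ≤ signChanges v ↔ ∃ S : Finset (Fin n), S.card = m + 1 ∧ ∃ σ, Alternates v S σ := by
  rw [← exists_alternates_iff hm]
  have hb : BddAbove {m | ∃ f : Fin (m + 1) → Fin n, StrictMono f ∧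
      ∀ j : Fin m, v (f j.castSucc) * v (f j.succ) < 0} :=
    ⟨n, fun _ h => le_of_mem_signChanges h⟩
  refine ⟨fun h => ?_, fun h => le_csSup hb h⟩
  have hne : {m | ∃ f : Fin (m + 1) → Fin n, StrictMono f ∧
      ∀ j : Fin m, v (f j.castSucc) * v (f j.succ) < 0}.Nonempty := by
    rw [Set.nonempty_iff_ne_empty]
    intro h0
    rw [signChanges, h0] at h
    simp at h
    omega
  obtain ⟨f, hf, hv⟩ := Nat.sSup_mem hne hb
  have hle : m + 1 ≤ signChanges v + 1 := by omega
  exact ⟨f ∘ Fin.castLE hle, hf.comp (Fin.strictMono_castLE hle), fun j =>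
    hv ⟨j, by have := j.2; unfold signChanges at h; omega⟩⟩

lemma signChanges_le {n : ℕ} (v : Fin n → ℝ) : signChanges v ≤ n := by
  rcases Nat.eq_zero_or_pos (signChanges v) with h | h
  · omega
  · obtain ⟨S, hS, -⟩ := (le_signChanges_iff h v).1 le_rfl
    have := S.card_le_univ
    simp only [Fintype.card_fin] at this
    omega

lemma sq_sign (m : ℕ) : ((-1 : ℝ) ^ m) * (-1) ^ m = 1 := by
  rw [← mul_pow]; simp

lemma le_varBar_iff {n m : ℕ} (hm : 0 < m) (w : Fin n → ℝ) :
    m ≤ varBar w ↔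
      ∃ S : Finset (Fin n), S.card = m + 1 ∧ ∃ σ, σ ≠ 0 ∧ WeaklyAlternates w S σ := by
  have hb : BddAbove {m | ∃ u : Fin n → ℝ, (∀ i, w i ≠ 0 → u i = w i) ∧ signChanges u = m} :=
    ⟨n, by rintro _ ⟨u, -, rfl⟩; exact signChanges_le u⟩
  constructor
  · intro h
    have hne : {m | ∃ u : Fin n → ℝ, (∀ i, w i ≠ 0 → u i = w i) ∧ signChanges u = m}.Nonempty :=
      ⟨_, w, fun _ _ => rfl, rfl⟩
    obtain ⟨u, hu, hs⟩ := Nat.sSup_mem hne hb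
    rw [varBar, ← hs, le_signChanges_iff hm] at h
    obtain ⟨S, hS, σ, hσ⟩ := h
    refine ⟨S, hS, σ, ?_, fun i hi => ?_⟩
    · rintro rfl
      obtain ⟨i, hi⟩ := Finset.card_pos.1 (by omega : 0 < S.card)
      simpa using hσ i hi
    · by_cases hw : w i = 0
      · simp [hw]
      · rw [← hu i hw]
        exact (hσ i hi).le
  · rintro ⟨S, hS, σ, hσ, h⟩
    let u : Fin n → ℝ := fun i => if w i = 0 then σ * (-1) ^ below S i else w i
    refine le_trans ?_ (le_csSup hb ⟨u, fun i hi => by simp [u, hi], rfl⟩)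
    rw [le_signChanges_iff hm]
    refine ⟨S, hS, σ, fun i hi => ?_⟩
    by_cases hw : w i = 0
    · simp only [u, hw, if_true]
      exact mul_self_pos.2 (by positivity)
    · simp only [u, hw, if_false]
      exact lt_of_le_of_ne (h i hi) (by positivity)

lemma card_filter_lt_succ {n t : ℕ} (ht : t < n) (S : Finset (Fin n)) :
    (S.filter (fun i => i.val < t + 1)).card =
      (S.filter (fun i => i.val < t)).card + if (⟨t, ht⟩ : Fin n) ∈ S then 1 else 0 := by
  split_ifs with h
  · rw [← Finset.card_insert_of_notMem (a := (⟨t, ht⟩ : Fin n)) (by simp)]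
    congr 1
    ext i
    simp only [Finset.mem_filter, Finset.mem_insert, Fin.ext_iff]
    constructor
    · rintro ⟨h1, h2⟩
      by_cases h3 : i.val = t
      · exact Or.inl h3
      · exact Or.inr ⟨h1, by omega⟩
    · rintro (h1 | h1)
      · exact ⟨by rwa [show i = ⟨t, ht⟩ from Fin.ext h1], by omega⟩
      · exact ⟨h1.1, by omega⟩
  · rw [add_zero]
    congr 1
    ext i
    simp only [Finset.mem_filter]
    refine ⟨fun ⟨h1, h2⟩ => ⟨h1, ?_⟩, fun ⟨h1, h2⟩ => ⟨h1, by omega⟩⟩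
    have : i.val ≠ t := fun h3 => h (by rwa [← show i = ⟨t, ht⟩ from Fin.ext h3])
    omega

lemma card_le_of_parity {n c : ℕ} (hc : c ≤ 1) (S R : Finset (Fin n))
    (h : ∀ i ∈ S, i ∉ R → (below S i + below R i) % 2 = c) : S.card ≤ R.card + 1 := by
  have key : ∀ t ≤ n, (S.filter (fun i => i.val < t)).card + c ≤
      (R.filter (fun i => i.val < t)).card + 1 := by
    intro t
    induction t with
    | zero => intro _; simpa using hc
    | succ t ih =>
      intro ht
      have h1 := ih (by omega)
      rw [card_filter_lt_succ ht, card_filter_lt_succ ht]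
      have h2 := h ⟨t, ht⟩
      simp only [below, Fin.lt_def] at h2
      split_ifs with h3 h4 h4
      · omega
      · have := h2 h3 h4
        omega
      · omega
      · omega
  have := key n le_rfl
  simp only [Fin.is_lt, Finset.filter_true] at this
  omega

/-- A vector whose signs are constant after reversing at each element of `R` cannot be compatible
with an alternating pattern on a set with more than `#R + 1` elements. -/
lemma card_le_of_weaklyAlternates {n : ℕ} {w : Fin n → ℝ} {S R : Finset (Fin n)} {σ τ : ℝ}
    (hσ : σ ≠ 0) (hS : WeaklyAlternates w S σ)
    (hR : ∀ i ∉ R, 0 < τ * (-1) ^ below R i * w i) : S.card ≤ R.card + 1 := by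
  have key : ∀ i ∈ S, i ∉ R → 0 < σ * τ * (-1) ^ (below S i + below R i) := by
    intro i hi hi'
    have h1 := hS i hi
    have h2 := hR i hi'
    have h3 : w i ≠ 0 := by rintro h; simp [h] at h2
    have h4 : 0 < σ * (-1) ^ below S i * w i := lt_of_le_of_ne h1 (by positivity)
    have h5 := mul_pos h4 h2
    refine pos_of_mul_pos_left (b := w i ^ 2) ?_ (sq_nonneg _)
    rw [pow_add]
    linarith
  rcases lt_or_ge 0 (σ * τ) with h | h
  · refine card_le_of_parity (c := 0) (by omega) S R fun i hi hi' => ?_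
    rcases Nat.mod_two_eq_zero_or_one (below S i + below R i) with h0 | h0
    · exact h0
    · have := key i hi hi'
      rw [(Nat.odd_iff.2 h0).neg_one_pow] at this
      linarith
  · refine card_le_of_parity (c := 1) (by omega) S R fun i hi hi' => ?_
    rcases Nat.mod_two_eq_zero_or_one (below S i + below R i) with h0 | h0
    · have := key i hi hi'
      rw [(Nat.even_iff.2 h0).neg_one_pow] at this
      linarith
    · exact h0

lemma exists_greedy {n : ℕ} (w : Fin n → ℝ) (σ : ℝ) :
    ∃ S : Finset (Fin n), ∀ i, i ∈ S ↔ 0 ≤ σ * (-1) ^ below S i * w i := by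
  suffices h : ∀ t ≤ n, ∃ S : Finset (Fin n), (∀ i ∈ S, i.val < t) ∧
      ∀ i : Fin n, i.val < t → (i ∈ S ↔ 0 ≤ σ * (-1) ^ below S i * w i) by
    obtain ⟨S, -, hS⟩ := h n le_rfl
    exact ⟨S, fun i => hS i i.2⟩
  intro t
  induction t with
  | zero => exact fun _ => ⟨∅, by simp, by simp⟩
  | succ t ih =>
    intro ht
    obtain ⟨S, hlt, hS⟩ := ih (by omega)
    by_cases h : 0 ≤ σ * (-1) ^ below S ⟨t, ht⟩ * w ⟨t, ht⟩
    · have hb : ∀ i : Fin n, i.val < t + 1 → below (insert ⟨t, ht⟩ S) i = below S i := by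
        intro i hi
        rw [below, Finset.filter_insert, if_neg, below]
        simp only [Fin.lt_def]
        omega
      refine ⟨insert ⟨t, ht⟩ S, ?_, fun i hi => ?_⟩
      · intro i hi
        rcases Finset.mem_insert.1 hi with rfl | hi
        · simp
        · have := hlt i hi
          omega
      · rw [hb i hi, Finset.mem_insert]
        by_cases hit : i = ⟨t, ht⟩
        · subst hit
          simpa using h
        · have : i.val ≠ t := fun h3 => hit (Fin.ext h3)
          rw [← hS i (by omega)]
          simp [hit]
    · refine ⟨S, fun i hi => by have := hlt i hi; omega, fun i hi => ?_⟩
      by_cases hit : i = ⟨t, ht⟩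
      · subst hit
        refine ⟨fun h1 => ?_, fun h1 => absurd h1 h⟩
        simpa using hlt _ h1
      · have : i.val ≠ t := fun h3 => hit (Fin.ext h3)
        exact hS i (by omega)

/-- If a nonzero vector is not compatible with an alternating pattern on `m + 1` elements, then
its signs become constant after reversing at fewer than `m` elements, off these elements. -/
lemma exists_flips {n m : ℕ} {w : Fin n → ℝ} (hw : w ≠ 0)
    (h : ∀ S : Finset (Fin n), S.card = m + 1 → ∀ σ, σ ≠ 0 → ¬ WeaklyAlternates w S σ) :
    ∃ R : Finset (Fin n), R.card + 1 ≤ m ∧ ∃ τ, ∀ i ∉ R, 0 < τ * (-1) ^ below R i * w i := by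
  classical
  have hne : (Finset.univ.filter (fun i => w i ≠ 0)).Nonempty := by
    obtain ⟨i, hi⟩ := Function.ne_iff.1 hw
    exact ⟨i, by simpa using hi⟩
  obtain ⟨p, hp, hmin⟩ := Finset.exists_min_image _ id hne
  have hwp : w p ≠ 0 := by simpa using hp
  have hz : ∀ i < p, w i = 0 := by
    intro i hi
    by_contra h0
    exact absurd (hmin i (by simpa using h0)) (not_le.2 hi)
  set σ : ℝ := (-1) ^ (p : ℕ) * w p with hσ
  have hσ0 : σ ≠ 0 := by positivity
  obtain ⟨S, hS⟩ := exists_greedy w σ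
  have hlt : ∀ i < p, i ∈ S := fun i hi => by rw [hS, hz i hi]; simp
  have hbp : below S p = p := by
    rw [below, show S.filter (· < p) = Finset.Iio p by
      ext i; simpa using hlt i, Fin.card_Iio]
  have hpos : 0 < σ * (-1) ^ below S p * w p := by
    rw [hbp, hσ]
    have : (-1) ^ (p : ℕ) * w p * (-1) ^ (p : ℕ) * w p = w p ^ 2 := by
      linear_combination w p ^ 2 * sq_sign p
    rw [this]
    positivity
  have hpS : p ∈ S := (hS p).2 hpos.le
  have hcard : S.card ≤ m := by
    by_contra! hc
    obtain ⟨T, hTS, hT, hb⟩ := exists_initial (Nat.succ_le_of_lt hc)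
    exact h T hT σ hσ0 fun i hi => by rw [hb i hi]; exact (hS i).1 (hTS hi)
  refine ⟨S.erase p, by rw [Finset.card_erase_add_one hpS]; exact hcard, σ, fun i hi => ?_⟩
  by_cases hip : i = p
  · subst hip
    rwa [below, Finset.filter_erase, Finset.erase_eq_of_notMem (by simp)]
  · have hiS : i ∉ S := fun hh => hi (Finset.mem_erase.2 ⟨hip, hh⟩)
    have hpi : p < i := lt_of_le_of_ne (not_lt.1 fun hh => hiS (hlt i hh)) (Ne.symm hip)
    have hb : below S i = below (S.erase p) i + 1 := by
      rw [below, below, Finset.filter_erase, Finset.card_erase_add_one]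
      simp [hpS, hpi]
    have := not_le.1 (mt (hS i).2 hiS)
    rw [hb, pow_succ] at this
    linarith

/-- The vectors of `U` vanishing on `S`. -/
def vanishing {n : ℕ} (U : Submodule ℝ (Fin n → ℝ)) (S : Finset (Fin n)) :
    Submodule ℝ (Fin n → ℝ) where
  carrier := {u | u ∈ U ∧ ∀ i ∈ S, u i = 0}
  add_mem' := fun ha hb => ⟨U.add_mem ha.1 hb.1, fun i hi => by simp [ha.2 i hi, hb.2 i hi]⟩
  zero_mem' := ⟨U.zero_mem, fun _ _ => rfl⟩
  smul_mem' := fun c _ ha => ⟨U.smul_mem c ha.1, fun i hi => by simp [ha.2 i hi]⟩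

lemma exists_prescribed {n : ℕ} {U : Submodule ℝ (Fin n → ℝ)} {S A : Finset (Fin n)}
    (hAS : A ⊆ S) (hA : ∀ i ∈ A, ∃ u ∈ U, (∀ x ∈ S, x ≠ i → u x = 0) ∧ u i ≠ 0)
    {v : Fin n → ℝ} (hv : v ∈ U) (g : Fin n → ℝ) :
    ∃ v' ∈ U, (∀ x ∈ S, x ∉ A → v' x = v x) ∧ ∀ x ∈ A, v' x = g x := by
  induction A using Finset.induction_on with
  | empty => exact ⟨v, hv, fun _ _ _ => rfl, by simp⟩
  | insert a A ha ih =>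
    obtain ⟨v', hv', h1, h2⟩ := ih ((Finset.subset_insert _ _).trans hAS)
      fun i hi => hA i (Finset.mem_insert_of_mem hi)
    obtain ⟨u, hu, hu0, hua⟩ := hA a (Finset.mem_insert_self _ _)
    refine ⟨v' + ((g a - v' a) / u a) • u, U.add_mem hv' (U.smul_mem _ hu), ?_, ?_⟩
    · intro x hx hxA
      rw [Finset.mem_insert, not_or] at hxA
      simp [h1 x hx hxA.2, hu0 x hx hxA.1]
    · intro x hx
      rcases Finset.mem_insert.1 hx with rfl | hxA
      · simp [hua]
      · have hxa : x ≠ a := by rintro rfl; exact ha hxA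
        simp [h2 x hxA, hu0 x (hAS hx) hxa]

lemma card_le_finrank {n : ℕ} {U : Submodule ℝ (Fin n → ℝ)} {S : Finset (Fin n)}
    (hS : ∀ i ∈ S, ∃ u ∈ U, (∀ x ∈ S, x ≠ i → u x = 0) ∧ u i ≠ 0) :
    S.card ≤ Module.finrank ℝ U := by
  classical
  let ρ : U →ₗ[ℝ] (S → ℝ) := LinearMap.funLeft ℝ ℝ (fun i : S => (i : Fin n)) ∘ₗ U.subtype
  have hρ : Function.Surjective ρ := by
    intro g
    obtain ⟨v, hv, -, h⟩ := exists_prescribed subset_rfl hS U.zero_mem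
      (fun i => if h : i ∈ S then g ⟨i, h⟩ else 0)
    refine ⟨⟨v, hv⟩, funext fun i => ?_⟩
    have := h i i.2
    simpa [ρ, LinearMap.funLeft] using this
  have := LinearMap.finrank_le_finrank_of_surjective hρ
  simpa using this

lemma exists_adjacent {n : ℕ} {N : Finset (Fin n)} (hN : N.Nonempty) (j : Fin n) (hj : j ∉ N) :
    ∃ d ∈ N, ∀ i ∈ N, i ≠ d → (d < i ↔ j < i) := by
  by_cases h : (N.filter (· < j)).Nonempty
  · obtain ⟨d, hd, hmax⟩ := Finset.exists_max_image _ id h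
    rw [Finset.mem_filter] at hd
    refine ⟨d, hd.1, fun i hi hid => ⟨fun hdi => ?_, fun hji => hd.2.trans hji⟩⟩
    have hij : i ≠ j := by rintro rfl; exact hj hi
    refine lt_of_le_of_ne (not_lt.1 fun hlt => ?_) hij.symm
    exact absurd (hmax i (Finset.mem_filter.2 ⟨hi, hlt⟩)) (not_le.2 hdi)
  · obtain ⟨d, hd, hmin⟩ := Finset.exists_min_image _ id hN
    refine ⟨d, hd, fun i hi hid => ⟨fun _ => ?_, fun _ => ?_⟩⟩
    · have hij : i ≠ j := by rintro rfl; exact hj hi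
      refine lt_of_le_of_ne (not_lt.1 fun hlt => ?_) hij.symm
      exact h ⟨i, Finset.mem_filter.2 ⟨hi, hlt⟩⟩
    · exact lt_of_le_of_ne (hmin i hi) hid.symm

lemma below_exchange {n : ℕ} {S : Finset (Fin n)} {d j i : Fin n} (hd : d ∈ S) (hj : j ∉ S)
    (h : d < i ↔ j < i) : below (insert j (S.erase d)) i = below S i := by
  rw [below, below, Finset.filter_insert, Finset.filter_erase]
  split_ifs with hji
  · rw [Finset.card_insert_of_notMem (by simp [hj]),
      Finset.card_erase_add_one (by simp [hd, h.2 hji])]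
  · rw [Finset.erase_eq_of_notMem]
    simp [mt h.1 hji]

/-- An alternating vector on more than `finrank U` positions can be exchanged for one whose set of
positions determines the vectors of `U`. -/
lemma exists_alternates_vanishing_eq_bot {n m : ℕ} {U : Submodule ℝ (Fin n → ℝ)}
    (hm : Module.finrank ℝ U < m) {σ : ℝ} {v : Fin n → ℝ} (hv : v ∈ U) {S : Finset (Fin n)}
    (hS : S.card = m) (hσ : Alternates v S σ) :
    ∃ v' ∈ U, ∃ T : Finset (Fin n), T.card = m ∧ Alternates v' T σ ∧ vanishing U T = ⊥ := by
  classical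
  induction hr : Module.finrank ℝ (vanishing U S) using Nat.strong_induction_on
    generalizing S v with
  | _ r ih =>
  by_cases hbot : vanishing U S = ⊥
  · exact ⟨v, hv, S, hS, hσ, hbot⟩
  obtain ⟨u, huS, hu0⟩ := (Submodule.ne_bot_iff _).1 hbot
  obtain ⟨j, hj⟩ := Function.ne_iff.1 hu0
  have hjS : j ∉ S := fun h => hj (huS.2 j h)
  have hσ0 : σ ≠ 0 := by
    rintro rfl
    obtain ⟨i, hi⟩ := Finset.card_pos.1 (by omega : 0 < S.card)
    simpa using hσ i hi
  let A := S.filter (fun i => ∃ u ∈ U, (∀ x ∈ S, x ≠ i → u x = 0) ∧ u i ≠ 0)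
  have hA : ∀ i ∈ A, ∃ u ∈ U, (∀ x ∈ S, x ≠ i → u x = 0) ∧ u i ≠ 0 :=
    fun i hi => (Finset.mem_filter.1 hi).2
  have hN : (S \ A).Nonempty := by
    rw [Finset.sdiff_nonempty]
    intro hSA
    have := card_le_finrank fun i hi => hA i (hSA hi)
    omega
  obtain ⟨d, hdN, hd⟩ := exists_adjacent hN j (by simp [hjS])
  obtain ⟨hdS, hdA⟩ := Finset.mem_sdiff.1 hdN
  set T := insert j (S.erase d) with hT
  obtain ⟨v₁, hv₁, h1, h2⟩ := exists_prescribed (Finset.filter_subset _ _) hA hv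
    (fun i => σ * (-1) ^ below T i)
  have hlt : vanishing U T < vanishing U S := by
    refine lt_of_le_of_ne (fun x hx => ⟨hx.1, fun i hi => ?_⟩) fun heq => ?_
    · by_cases hid : i = d
      · subst hid
        by_contra hne
        refine hdA (Finset.mem_filter.2 ⟨hdS, x, hx.1, fun y hy hyi => ?_, hne⟩)
        exact hx.2 y (Finset.mem_insert_of_mem (Finset.mem_erase.2 ⟨hyi, hy⟩))
      · exact hx.2 i (Finset.mem_insert_of_mem (Finset.mem_erase.2 ⟨hid, hi⟩))
    · rw [← heq] at huS
      exact hj (huS.2 j (Finset.mem_insert_self _ _))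
  refine ih _ (hr ▸ Submodule.finrank_lt_finrank_of_lt hlt)
    (U.add_mem hv₁ (U.smul_mem ((σ * (-1) ^ below T j - v₁ j) / u j) huS.1)) ?_ ?_ rfl
  · rw [hT, Finset.card_insert_of_notMem (by simp [hjS]), Finset.card_erase_add_one hdS, hS]
  · intro i hi
    rcases Finset.mem_insert.1 hi with rfl | hi
    · have huj : u i ≠ 0 := hj
      simp only [Pi.add_apply, Pi.smul_apply, smul_eq_mul, div_mul_cancel₀ _ huj,
        add_sub_cancel]
      exact mul_self_pos.2 (by positivity)
    · obtain ⟨hid, hiS⟩ := Finset.mem_erase.1 hi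
      simp only [Pi.add_apply, Pi.smul_apply, smul_eq_mul, huS.2 i hiS, mul_zero, add_zero]
      by_cases hiA : i ∈ A
      · rw [h2 i hiA]
        exact mul_self_pos.2 (by positivity)
      · rw [h1 i hiS hiA, hT,
          below_exchange hdS hjS (hd i (Finset.mem_sdiff.2 ⟨hiS, hiA⟩) hid)]
        exact hσ i hiS

/-- Reversal of the signs at odd positions. -/
def alt {n : ℕ} : (Fin n → ℝ) →ₗ[ℝ] (Fin n → ℝ) where
  toFun v i := (-1) ^ (i : ℕ) * v i
  map_add' _ _ := funext fun _ => mul_add _ _ _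
  map_smul' _ _ := funext fun _ => mul_left_comm _ _ _

lemma alt_apply {n : ℕ} (v : Fin n → ℝ) (i : Fin n) : alt v i = (-1) ^ (i : ℕ) * v i := rfl

lemma alt_alt {n : ℕ} (v : Fin n → ℝ) : alt (alt v) = v := by
  ext i
  rw [alt_apply, alt_apply, ← mul_assoc, sq_sign, one_mul]

lemma finrank_comap_alt {n : ℕ} (W : Submodule ℝ (Fin n → ℝ)) :
    Module.finrank ℝ (W.comap alt) = Module.finrank ℝ W :=
  (Submodule.comap_equiv_eq_map_symm (LinearEquiv.ofInvolutive alt alt_alt) W ▸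
    LinearEquiv.finrank_map_eq (LinearEquiv.ofInvolutive alt alt_alt).symm W :)

lemma below_add_below_compl {n : ℕ} (S : Finset (Fin n)) (i : Fin n) :
    below S i + below Sᶜ i = i := by
  rw [below, below, ← Finset.card_union_of_disjoint, ← Finset.filter_union, Finset.union_compl]
  · rw [show Finset.univ.filter (· < i) = Finset.Iio i by ext; simp, Fin.card_Iio]
  · exact Finset.disjoint_filter_filter disjoint_compl_right

lemma sign_mul_below {n : ℕ} (S : Finset (Fin n)) (i : Fin n) :
    (-1 : ℝ) ^ below S i * (-1) ^ (i : ℕ) = (-1) ^ below Sᶜ i := by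
  rw [← below_add_below_compl S i, pow_add, ← mul_assoc, sq_sign, one_mul]

/-- `W` is the orthogonal complement of `V`. -/
def IsPerp {n : ℕ} (V W : Submodule ℝ (Fin n → ℝ)) : Prop :=
  ∀ w, w ∈ W ↔ ∀ v ∈ V, ∑ i, v i * w i = 0

lemma IsPerp.finrank_add_le {n : ℕ} {V W : Submodule ℝ (Fin n → ℝ)} (h : IsPerp V W) :
    Module.finrank ℝ V + Module.finrank ℝ W ≤ n := by
  have hd : V ⊓ W = ⊥ := by
    rw [Submodule.eq_bot_iff]
    rintro x ⟨hx, hx'⟩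
    have := (h x).1 hx' x hx
    rw [Finset.sum_eq_zero_iff_of_nonneg fun i _ => mul_self_nonneg _] at this
    ext i
    simpa using this i (Finset.mem_univ i)
  have h1 := Submodule.finrank_sup_add_finrank_inf_eq V W
  rw [hd, finrank_bot, add_zero] at h1
  have h2 := Submodule.finrank_le (V ⊔ W)
  rw [Module.finrank_fin_fun] at h2
  omega

lemma IsPerp.exists_eq_on {n : ℕ} {V W : Submodule ℝ (Fin n → ℝ)} (h : IsPerp V W)
    {R : Finset (Fin n)} (hR : ∀ w ∈ W, (∀ i ∉ R, w i = 0) → w = 0) (g : Fin n → ℝ) :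
    ∃ v ∈ V, ∀ i ∈ R, v i = g i := by
  classical
  let ρ : V →ₗ[ℝ] (R → ℝ) := LinearMap.funLeft ℝ ℝ (fun i : R => (i : Fin n)) ∘ₗ V.subtype
  have hρ : LinearMap.range ρ = ⊤ := by
    by_contra hne
    obtain ⟨f, hf, hle⟩ := Submodule.exists_le_ker_of_lt_top _ (lt_top_iff_ne_top.2 hne)
    let w : Fin n → ℝ := fun i => if hi : i ∈ R then f (Pi.single ⟨i, hi⟩ 1) else 0
    have hf' : ∀ x : R → ℝ, f x = ∑ i : R, x i * w i := by
      intro x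
      conv_lhs => rw [← Finset.univ_sum_single x]
      rw [map_sum]
      refine Finset.sum_congr rfl fun i _ => ?_
      have : Pi.single i (x i) = x i • (Pi.single i 1 : R → ℝ) := by
        rw [← Pi.single_smul, smul_eq_mul, mul_one]
      rw [this, map_smul, smul_eq_mul]
      simp [w]
    have hw : w ∈ W := by
      rw [h]
      intro v hv
      have h1 : f (ρ ⟨v, hv⟩) = 0 := hle ⟨_, rfl⟩
      rw [hf'] at h1
      rw [← Finset.sum_subset (Finset.subset_univ R), ← Finset.sum_coe_sort]
      · exact h1
      · intro i _ hi
        simp [w, hi]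
    have hw0 := hR w hw fun i hi => by simp [w, hi]
    exact hf (LinearMap.ext fun x => by rw [hf', hw0]; simp)
  obtain ⟨⟨v, hv⟩, hx⟩ := LinearMap.range_eq_top.1 hρ (fun i => g i)
  exact ⟨v, hv, fun i hi => congrFun hx ⟨i, hi⟩⟩

lemma exists_mem_vanishing {n : ℕ} {V : Submodule ℝ (Fin n → ℝ)} {R : Finset (Fin n)}
    (h : R.card < Module.finrank ℝ V) : ∃ v ∈ V, v ≠ 0 ∧ ∀ i ∈ R, v i = 0 := by
  let ρ : V →ₗ[ℝ] (R → ℝ) := LinearMap.funLeft ℝ ℝ (fun i : R => (i : Fin n)) ∘ₗ V.subtype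
  have : LinearMap.ker ρ ≠ ⊥ := LinearMap.ker_ne_bot_of_finrank_lt (by simpa using h)
  obtain ⟨⟨v, hv⟩, hk, h0⟩ := (Submodule.ne_bot_iff _).1 this
  exact ⟨v, hv, fun h => h0 (Subtype.ext h), fun i hi => congrFun hk ⟨i, hi⟩⟩

lemma below_insert {n : ℕ} {S : Finset (Fin n)} {b : Fin n} (hb : b ∉ S) (i : Fin n) :
    below (insert b S) i = below S i + if b < i then 1 else 0 := by
  rw [below, below, Finset.filter_insert]
  split_ifs
  · rw [Finset.card_insert_of_notMem (by simp [hb])]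
  · rfl

lemma exists_sign_insert_insert {n : ℕ} {R : Finset (Fin n)} {a b : Fin n} (ha : a ∉ R)
    (hb : b ∉ R) (hab : a ≠ b) {σ x y : ℝ} (hx : 0 < σ * (-1) ^ below R a * x)
    (hy : σ * (-1) ^ below R b * y < 0) :
    ∃ τ, 0 < τ * (-1) ^ below (insert a (insert b R)) a * x ∧
      0 < τ * (-1) ^ below (insert a (insert b R)) b * y := by
  have ha' : a ∉ insert b R := by simp [ha, hab]
  simp only [below_insert ha', below_insert hb, lt_irrefl, if_false, add_zero]
  rcases lt_or_gt_of_ne hab with h | h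
  · refine ⟨σ, by simpa [h.not_gt] using hx, ?_⟩
    simp only [h, if_true, pow_succ]
    linarith
  · refine ⟨-σ, ?_, ?_⟩
    · simp only [h, if_true, pow_succ]
      linarith
    · simp only [h.not_gt, if_false, add_zero]
      linarith

/-- Sign variation duality: an alternating vector in the complement, after reversal of the signs
at odd positions, yields an alternating vector on a complementary number of positions. -/
lemma IsPerp.exists_alternates {n d : ℕ} {V W : Submodule ℝ (Fin n → ℝ)} (h : IsPerp V W)
    (hd : 0 < d) (hdV : d ≤ Module.finrank ℝ V) {w : Fin n → ℝ} (hw : w ∈ W)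
    {S : Finset (Fin n)} {σ : ℝ} (hS : S.card = n - d + 1) (hσ : Alternates (alt w) S σ) :
    ∃ v ∈ V, ∃ T : Finset (Fin n), T.card = d + 1 ∧ ∃ τ, Alternates v T τ := by
  classical
  have hVW := h.finrank_add_le
  obtain ⟨u, hu, Q, hQ, huσ, hbot⟩ := exists_alternates_vanishing_eq_bot
    (U := W.comap alt) (m := n - d + 1) (by rw [finrank_comap_alt]; omega)
    (v := alt w) (by rwa [Submodule.mem_comap, alt_alt]) hS hσ
  have hR : Qᶜ.card + 1 = d := by
    rw [Finset.card_compl, hQ, Fintype.card_fin]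
    omega
  have hext := h.exists_eq_on (R := Qᶜ) fun x hx hx0 => by
    have : alt x ∈ vanishing (W.comap alt) Q :=
      ⟨by rwa [Submodule.mem_comap, alt_alt], fun i hi => by
        rw [alt_apply, hx0 i (by simpa using hi), mul_zero]⟩
    rw [hbot, Submodule.mem_bot] at this
    rw [← alt_alt x, this, map_zero]
  obtain ⟨v₀, hv₀, hne, hv₀R⟩ := exists_mem_vanishing (V := V) (R := Qᶜ) (by omega)
  have hsum := (h _).1 hu v₀ hv₀
  have hpos : ∀ i ∉ Qᶜ, 0 < σ * (-1) ^ below Qᶜ i * alt u i := by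
    intro i hi
    have := huσ i (by simpa using hi)
    rw [← sign_mul_below, alt_apply]
    linear_combination this - (σ * (-1) ^ below Q i * u i) * sq_sign i
  obtain ⟨i, hi⟩ := Function.ne_iff.1 hne
  have hiR : i ∉ Qᶜ := fun hh => hi (hv₀R i hh)
  have hterm : v₀ i * alt u i ≠ 0 := by
    refine mul_ne_zero hi fun hh => ?_
    simpa [hh] using hpos i hiR
  obtain ⟨a, -, ha⟩ := Finset.exists_pos_of_sum_zero_of_exists_nonzero _ hsum
    ⟨i, Finset.mem_univ i, hterm⟩
  obtain ⟨b, -, hb⟩ := Finset.exists_pos_of_sum_zero_of_exists_nonzero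
    (fun i => -(v₀ i * alt u i)) (by rw [Finset.sum_neg_distrib, hsum, neg_zero])
    ⟨i, Finset.mem_univ i, neg_ne_zero.2 hterm⟩
  have haR : a ∉ Qᶜ := fun hh => by simp [hv₀R a hh] at ha
  have hbR : b ∉ Qᶜ := fun hh => by simp [hv₀R b hh] at hb
  have hab : a ≠ b := by rintro rfl; linarith
  have hsa : 0 < σ * (-1) ^ below Qᶜ a * v₀ a := by
    refine pos_of_mul_pos_left (b := alt u a ^ 2) ?_ (sq_nonneg _)
    linarith [mul_pos (hpos a haR) ha]
  have hsb : σ * (-1) ^ below Qᶜ b * v₀ b < 0 := by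
    refine neg_pos.1 (pos_of_mul_pos_left (b := alt u b ^ 2) ?_ (sq_nonneg _))
    linarith [mul_pos (hpos b hbR) hb]
  obtain ⟨τ, hτa, hτb⟩ := exists_sign_insert_insert haR hbR hab hsa hsb
  set T := insert a (insert b Qᶜ) with hT
  have hτ : τ ≠ 0 := by rintro rfl; simp at hτa
  obtain ⟨g, hg, hgR⟩ := hext (fun i => τ * (-1) ^ below T i)
  obtain ⟨M, hMa, hMb⟩ := ((Filter.tendsto_id.atTop_mul_const hτa).eventually_gt_atTop
    (-(τ * (-1) ^ below T a * g a)) |>.and <|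
    (Filter.tendsto_id.atTop_mul_const hτb).eventually_gt_atTop
    (-(τ * (-1) ^ below T b * g b))).exists
  refine ⟨M • v₀ + g, V.add_mem (V.smul_mem M hv₀) hg, T, ?_, τ, fun i hi => ?_⟩
  · rw [hT, Finset.card_insert_of_notMem (by simp only [Finset.mem_insert]; tauto),
      Finset.card_insert_of_notMem hbR, hR]
  · rw [hT, Finset.mem_insert, Finset.mem_insert] at hi
    simp only [Pi.add_apply, Pi.smul_apply, smul_eq_mul]
    simp only [id] at hMa hMb
    rcases hi with rfl | rfl | hi
    · linarith
    · linarith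
    · rw [hv₀R i hi, hgR i hi, mul_zero, zero_add]
      exact mul_self_pos.2 (by positivity)

lemma IsPerp.symm_of_finrank {n k : ℕ} {V W : Submodule ℝ (Fin n → ℝ)} (h : IsPerp V W)
    (hV : Module.finrank ℝ V = k) : n - k ≤ Module.finrank ℝ W ∧ IsPerp W V := by
  let b := Module.finBasisOfFinrankEq ℝ V hV
  let ρ : (Fin n → ℝ) →ₗ[ℝ] (Fin k → ℝ) :=
    LinearMap.pi fun a => ∑ i, (b a : Fin n → ℝ) i • LinearMap.proj i
  have hρ : ∀ w a, ρ w a = ∑ i, (b a : Fin n → ℝ) i * w i := fun w a => by simp [ρ]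
  have hker : LinearMap.ker ρ = W := by
    ext w
    rw [h, LinearMap.mem_ker]
    constructor
    · intro h0 v hv
      have hlin : ∀ x : V, ∑ i, (x : Fin n → ℝ) i * w i = 0 := by
        intro x
        have hs : (fun x : V => ∑ i, (x : Fin n → ℝ) i * w i) =
            ((∑ i, w i • LinearMap.proj i : (Fin n → ℝ) →ₗ[ℝ] ℝ) ∘ₗ V.subtype) := by
          ext x
          simp [mul_comm]
        have hz : ((∑ i, w i • LinearMap.proj i : (Fin n → ℝ) →ₗ[ℝ] ℝ) ∘ₗ V.subtype) = 0 := by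
          refine b.ext fun a => ?_
          rw [← hs, LinearMap.zero_apply]
          exact (hρ w a).symm.trans (congrFun h0 a)
        have := congrFun hs x
        rw [hz] at this
        exact this
      exact hlin ⟨v, hv⟩
    · intro h0
      ext a
      rw [hρ, h0 _ (b a).2, Pi.zero_apply]
  have h1 := LinearMap.finrank_range_add_finrank_ker ρ
  have h2 := Submodule.finrank_le (LinearMap.range ρ)
  rw [hker, Module.finrank_fin_fun] at h1
  rw [Module.finrank_fin_fun] at h2
  let V' : Submodule ℝ (Fin n → ℝ) :=
    { carrier := {v | ∀ w ∈ W, ∑ i, w i * v i = 0}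
      add_mem' := fun ha hb w hw => by
        simp [mul_add, Finset.sum_add_distrib, ha w hw, hb w hw]
      zero_mem' := fun w _ => by simp
      smul_mem' := fun c v hv w hw => by
        simp [mul_left_comm, ← Finset.mul_sum, hv w hw] }
  have hW' : IsPerp W V' := fun _ => Iff.rfl
  have hle : V ≤ V' := fun v hv w hw => by
    rw [← (h w).1 hw v hv]
    exact Finset.sum_congr rfl fun i _ => mul_comm _ _
  have heq : V = V' := Submodule.eq_of_le_of_finrank_le hle (by
    have := hW'.finrank_add_le
    omega)
  exact ⟨by omega, heq ▸ hW'⟩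

lemma IsPerp.comap_alt {n : ℕ} {V W : Submodule ℝ (Fin n → ℝ)} (h : IsPerp V W) :
    IsPerp (V.comap alt) (W.comap alt) := by
  intro w
  rw [Submodule.mem_comap, h]
  constructor
  · intro h0 v hv
    rw [← h0 _ hv]
    refine Finset.sum_congr rfl fun i _ => ?_
    rw [alt_apply, alt_apply]
    linear_combination (-v i * w i) * sq_sign i
  · intro h0 v hv
    rw [← h0 (alt v) (by rwa [Submodule.mem_comap, alt_alt])]
    refine Finset.sum_congr rfl fun i _ => ?_
    rw [alt_apply, alt_apply]
    ring

lemma alternates_alt {n : ℕ} {w : Fin n → ℝ} {S : Finset (Fin n)} {σ : ℝ}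
    (h : ∀ i ∈ S, 0 < σ * (-1) ^ below Sᶜ i * w i) : Alternates (alt w) S σ := by
  intro i hi
  have := h i hi
  rw [← sign_mul_below] at this
  rw [alt_apply]
  linarith

lemma IsPerp.forall_signChanges_iff {n k : ℕ} {V W : Submodule ℝ (Fin n → ℝ)} (h : IsPerp V W)
    (hk : 0 < k) (hkn : k < n) (hV : Module.finrank ℝ V = k) :
    (∀ v ∈ V, signChanges v ≤ k - 1) ↔ ∀ w ∈ W, w ≠ 0 → k ≤ varBar w := by
  constructor
  · intro hb w hw hw0
    by_contra hlt
    rw [le_varBar_iff hk] at hlt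
    push Not at hlt
    obtain ⟨R, hR, τ, hτ⟩ := exists_flips hw0 hlt
    have hcard : n - k + 1 ≤ Rᶜ.card := by
      rw [Finset.card_compl, Fintype.card_fin]
      omega
    have halt : Alternates (alt w) Rᶜ τ := alternates_alt fun i hi => by
      rw [compl_compl]
      exact hτ i (by simpa using hi)
    obtain ⟨T, hTR, hT, hbelow⟩ := exists_initial hcard
    obtain ⟨v, hv, S, hS, σ, hσ⟩ := h.exists_alternates hk hV.ge hw hT (σ := τ)
      fun i hi => by rw [hbelow i hi]; exact halt i (hTR hi)
    have h1 := (le_signChanges_iff hk v).2 ⟨S, hS, σ, hσ⟩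
    have h2 := hb v hv
    omega
  · intro hc v hv
    by_contra hlt
    obtain ⟨S, hS, σ, hσ⟩ := (le_signChanges_iff hk v).1 (by omega)
    obtain ⟨hW, hWV⟩ := h.symm_of_finrank hV
    obtain ⟨u, hu, T, hT, τ, hτ⟩ := hWV.comap_alt.exists_alternates (d := n - k) (by omega)
      (by rwa [finrank_comap_alt]) (w := alt v) (by rwa [Submodule.mem_comap, alt_alt])
      (S := S) (σ := σ) (by omega) (by rwa [alt_alt])
    have hne : alt u ≠ 0 := by
      intro h0
      obtain ⟨i, hi⟩ := Finset.card_pos.1 (by omega : 0 < T.card)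
      have := hτ i hi
      rw [← alt_alt u, h0] at this
      simp at this
    obtain ⟨Q, hQ, ρ, hρ, hweak⟩ := (le_varBar_iff hk _).1 (hc _ hu hne)
    have := card_le_of_weaklyAlternates (R := Tᶜ) (τ := τ) hρ hweak fun i hi => by
      have := hτ i (by simpa using hi)
      rw [← sign_mul_below, alt_apply]
      linear_combination this - (τ * (-1) ^ below T i * u i) * sq_sign i
    rw [Finset.card_compl, Fintype.card_fin] at this
    omega

lemma pluck_image {k n : ℕ} (C : Matrix (Fin k) (Fin n) ℝ) {f : Fin k → Fin n}
    (hf : StrictMono f) {S : Finset (Fin n)} (hS : Finset.univ.image f = S) (h : S.card = k) :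
    pluck C S h = (C.submatrix id f).det := by
  have : f = S.orderEmbOfFin h := Finset.orderEmbOfFin_unique h
    (fun x => hS ▸ Finset.mem_image_of_mem f (Finset.mem_univ x)) hf
  rw [this]
  rfl

lemma exists_pluck_erase {k n : ℕ} (C : Matrix (Fin k) (Fin n) ℝ) {S : Finset (Fin n)}
    (hS : S.card = k + 1) {s : Fin n} (hs : s ∈ S) (h : (S.erase s).card = k) :
    ∃ p : Fin (k + 1), pluck C (S.erase s) h =
      (C.submatrix id (S.orderEmbOfFin hS ∘ p.succAbove)).det := by
  rw [← image_orderEmbOfFin hS, Finset.mem_image] at hs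
  obtain ⟨p, -, rfl⟩ := hs
  refine ⟨p, pluck_image C ((S.orderEmbOfFin hS).strictMono.comp p.strictMono_succAbove) ?_ h⟩
  ext x
  rw [Finset.mem_erase]
  nth_rw 3 [← image_orderEmbOfFin hS]
  simp only [Finset.mem_image, Finset.mem_univ, true_and, Function.comp_apply]
  constructor
  · rintro ⟨a, rfl⟩
    exact ⟨fun h => p.succAbove_ne a ((S.orderEmbOfFin hS).injective h), _, rfl⟩
  · rintro ⟨hne, a, rfl⟩
    obtain ⟨c, rfl⟩ := Fin.exists_succAbove_eq (show a ≠ p by rintro rfl; exact hne rfl)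
    exact ⟨c, rfl⟩

lemma sum_minors_eq_zero {k n : ℕ} (C : Matrix (Fin k) (Fin n) ℝ) (x : Fin k → ℝ)
    (g : Fin (k + 1) → Fin n) :
    ∑ p : Fin (k + 1), (-1) ^ (p : ℕ) * Matrix.vecMul x C (g p) *
      (C.submatrix id (g ∘ p.succAbove)).det = 0 := by
  let M : Matrix (Fin (k + 1)) (Fin (k + 1)) ℝ :=
    Matrix.of (Fin.cons (fun p => Matrix.vecMul x C (g p)) (fun a p => C a (g p)))
  have h0 : M.det = 0 := by
    rw [← Matrix.exists_vecMul_eq_zero_iff]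
    refine ⟨Fin.cons 1 (-x), fun h => by simpa using congrFun h 0, ?_⟩
    ext p
    simp [M, Matrix.vecMul, dotProduct, Fin.sum_univ_succ]
  rw [Matrix.det_succ_row_zero] at h0
  exact h0

lemma mem_span_rows_iff {k n : ℕ} (C : Matrix (Fin k) (Fin n) ℝ) (v : Fin n → ℝ) :
    v ∈ Submodule.span ℝ (Set.range fun i => C i) ↔ ∃ x, Matrix.vecMul x C = v := by
  rw [Submodule.mem_span_range_iff_exists_fun]
  simp only [Matrix.vecMul_eq_sum]

lemma vecMul_eq_zero {k n : ℕ} {C : Matrix (Fin k) (Fin n) ℝ}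
    (hC : LinearIndependent ℝ fun i => C i) {x : Fin k → ℝ} (hx : Matrix.vecMul x C = 0) :
    x = 0 := by
  rw [Matrix.vecMul_eq_sum] at hx
  exact funext (Fintype.linearIndependent_iff.1 hC x hx)

lemma pluck_ne_zero_iff {k n : ℕ} {C : Matrix (Fin k) (Fin n) ℝ}
    (hC : LinearIndependent ℝ fun i => C i) {S : Finset (Fin n)} (h : S.card = k) :
    pluck C S h ≠ 0 ↔ vanishing (Submodule.span ℝ (Set.range fun i => C i)) S = ⊥ := by
  rw [Ne, pluck, ← Matrix.exists_vecMul_eq_zero_iff, Submodule.eq_bot_iff]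
  have hvec : ∀ x : Fin k → ℝ, Matrix.vecMul x
      (C.submatrix id (fun t => ((S.orderIsoOfFin h) t).val)) = 0 ↔
      ∀ i ∈ S, Matrix.vecMul x C i = 0 := by
    intro x
    constructor
    · intro h0 i hi
      have : Matrix.vecMul x C (S.orderIsoOfFin h ((S.orderIsoOfFin h).symm ⟨i, hi⟩)).val = 0 :=
        congrFun h0 _
      rwa [OrderIso.apply_symm_apply] at this
    · intro h0
      ext t
      exact h0 _ ((S.orderIsoOfFin h) t).2
  simp only [hvec]
  constructor
  · rintro hne v ⟨hv, hv0⟩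
    obtain ⟨x, rfl⟩ := (mem_span_rows_iff C v).1 hv
    by_contra hv'
    exact hne ⟨x, by rintro rfl; simp at hv', hv0⟩
  · rintro hbot ⟨x, hx, hx0⟩
    exact hx (vecMul_eq_zero hC (hbot _ ⟨(mem_span_rows_iff C _).2 ⟨x, rfl⟩, hx0⟩))

lemma exists_minor_ne_zero {k n : ℕ} {C : Matrix (Fin k) (Fin n) ℝ} {g : Fin (k + 1) → Fin n}
    (h : ∀ y : Fin k → ℝ, (∀ p, Matrix.vecMul y C (g p) = 0) → y = 0) :
    ∃ p : Fin (k + 1), (C.submatrix id (g ∘ p.succAbove)).det ≠ 0 := by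
  have hker : LinearMap.ker (C.submatrix id g).mulVecLin ≠ ⊥ :=
    LinearMap.ker_ne_bot_of_finrank_lt (by simp)
  obtain ⟨z, hz, hz0⟩ := (Submodule.ne_bot_iff _).1 hker
  obtain ⟨p, hp⟩ := Function.ne_iff.1 hz0
  refine ⟨p, fun hdet => ?_⟩
  obtain ⟨y, hy0, hy⟩ := Matrix.exists_vecMul_eq_zero_iff.2 hdet
  refine hy0 (h y fun q => ?_)
  have hy' : ∀ c, Matrix.vecMul y C (g (p.succAbove c)) = 0 := fun c => congrFun hy c
  have hdot : ∑ q, Matrix.vecMul y C (g q) * z q = 0 := by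
    have := Matrix.dotProduct_mulVec y (C.submatrix id g) z
    rw [show Matrix.mulVec (C.submatrix id g) z = 0 from hz, dotProduct_zero] at this
    exact this.symm
  rw [Fin.sum_univ_succAbove _ p] at hdot
  simp only [hy', zero_mul, Finset.sum_const_zero, add_zero] at hdot
  rcases Fin.eq_self_or_eq_succAbove p q with rfl | ⟨c, rfl⟩
  · exact (mul_eq_zero.1 hdot).resolve_right hp
  · exact hy' c

lemma TotNonneg.not_alternates {k n : ℕ} {V : Submodule ℝ (Fin n → ℝ)} (h : TotNonneg k V)
    (hV : Module.finrank ℝ V = k) {v : Fin n → ℝ} (hv : v ∈ V) {S : Finset (Fin n)}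
    (hS : S.card = k + 1) (σ : ℝ) : ¬ Alternates v S σ := by
  intro hσ
  obtain ⟨C, hC, hspan, hpos⟩ := h
  obtain ⟨v, hv, S, hS, hσ, hbot⟩ := exists_alternates_vanishing_eq_bot (by omega) hv hS hσ
  rw [← hspan] at hv hbot
  obtain ⟨x, rfl⟩ := (mem_span_rows_iff C v).1 hv
  set g := S.orderEmbOfFin hS
  have hdet : ∀ p : Fin (k + 1), 0 ≤ (C.submatrix id (g ∘ p.succAbove)).det := by
    intro p
    have hmono := g.strictMono.comp p.strictMono_succAbove
    have hcard : (Finset.univ.image (g ∘ p.succAbove)).card = k := by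
      rw [Finset.card_image_of_injective _ hmono.injective, Finset.card_univ, Fintype.card_fin]
    rw [← pluck_image C hmono rfl hcard]
    exact hpos _ _
  have hpos' : ∀ p : Fin (k + 1), 0 < σ * ((-1) ^ (p : ℕ) * Matrix.vecMul x C (g p)) := by
    intro p
    have := hσ (g p) (Finset.orderEmbOfFin_mem S hS p)
    rw [below_orderEmbOfFin] at this
    linarith
  obtain ⟨p, hp⟩ := exists_minor_ne_zero (C := C) (g := g) fun y hy => by
    refine vecMul_eq_zero hC ?_
    have : Matrix.vecMul y C ∈ vanishing (Submodule.span ℝ (Set.range fun i => C i)) S := by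
      refine ⟨(mem_span_rows_iff C _).2 ⟨y, rfl⟩, fun i hi => ?_⟩
      rw [← image_orderEmbOfFin hS, Finset.mem_image] at hi
      obtain ⟨p, -, rfl⟩ := hi
      exact hy p
    rwa [hbot, Submodule.mem_bot] at this
  have hsum := congrArg (σ * ·) (sum_minors_eq_zero C x g)
  simp only [Finset.mul_sum, mul_zero] at hsum
  refine hsum.not_gt (Finset.sum_pos' (fun q _ => ?_) ⟨p, Finset.mem_univ p, ?_⟩)
  · rw [← mul_assoc]
    exact mul_nonneg (hpos' q).le (hdet q)
  · rw [← mul_assoc]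
    exact mul_pos (hpos' p) (lt_of_le_of_ne (hdet p) hp.symm)

lemma exists_pos_sum_mul_eq_zero {ι : Type*} [Fintype ι] [DecidableEq ι] {q : ι → ℝ} {a b : ι}
    (ha : 0 < q a) (hb : q b < 0) : ∃ t : ι → ℝ, (∀ i, 0 < t i) ∧ ∑ i, t i * q i = 0 := by
  have key : ∀ (c : ι) (r : ℝ), ∑ i, (1 + if i = c then r else 0) * q i = ∑ i, q i + r * q c := by
    intro c r
    simp [add_mul, Finset.sum_add_distrib]
  rcases le_total 0 (∑ i, q i) with h | h
  · refine ⟨fun i => 1 + if i = b then (∑ i, q i) / (-q b) else 0, fun i => ?_, ?_⟩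
    · have : 0 ≤ (∑ i, q i) / (-q b) := div_nonneg h (by linarith)
      dsimp only
      split_ifs <;> linarith
    · rw [key, div_neg, neg_mul, div_mul_cancel₀ _ hb.ne, add_neg_cancel]
  · refine ⟨fun i => 1 + if i = a then (-∑ i, q i) / q a else 0, fun i => ?_, ?_⟩
    · have : 0 ≤ (-∑ i, q i) / q a := div_nonneg (by linarith) ha.le
      dsimp only
      split_ifs <;> linarith
    · rw [key, div_mul_cancel₀ _ ha.ne', add_neg_cancel]

/-- Two minors of opposite signs inside `k + 1` columns yield an alternating vector. -/
lemma exists_alternates_of_minors {k n : ℕ} {C : Matrix (Fin k) (Fin n) ℝ} {S : Finset (Fin n)}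
    (hS : S.card = k + 1) {a b : Fin (k + 1)}
    (ha : 0 < (C.submatrix id (S.orderEmbOfFin hS ∘ a.succAbove)).det)
    (hb : (C.submatrix id (S.orderEmbOfFin hS ∘ b.succAbove)).det < 0) :
    ∃ x : Fin k → ℝ, Alternates (Matrix.vecMul x C) S 1 := by
  set g := S.orderEmbOfFin hS
  obtain ⟨t, ht, hsum⟩ := exists_pos_sum_mul_eq_zero
    (q := fun p : Fin (k + 1) => (C.submatrix id (g ∘ p.succAbove)).det) ha hb
  set M := C.submatrix id (g ∘ a.succAbove)
  let y : Fin k → ℝ := fun c => (-1) ^ (a.succAbove c : ℕ) * t (a.succAbove c)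
  let x := Matrix.vecMul y M⁻¹
  have hx : Matrix.vecMul x M = y := by
    rw [Matrix.vecMul_vecMul, Matrix.nonsing_inv_mul _ (IsUnit.mk0 _ ha.ne'), Matrix.vecMul_one]
  have hx' : ∀ c, Matrix.vecMul x C (g (a.succAbove c)) = y c := fun c => congrFun hx c
  have hcr := sum_minors_eq_zero C x g
  rw [Fin.sum_univ_succAbove _ a] at hcr hsum
  have hrest : ∑ c, (-1) ^ (a.succAbove c : ℕ) * Matrix.vecMul x C (g (a.succAbove c)) *
      (C.submatrix id (g ∘ (a.succAbove c).succAbove)).det =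
      ∑ c, t (a.succAbove c) * (C.submatrix id (g ∘ (a.succAbove c).succAbove)).det := by
    refine Finset.sum_congr rfl fun c _ => ?_
    rw [hx']
    linear_combination (t (a.succAbove c) *
      (C.submatrix id (g ∘ (a.succAbove c).succAbove)).det) * sq_sign (a.succAbove c)
  rw [hrest] at hcr
  have hxa : (-1) ^ (a : ℕ) * Matrix.vecMul x C (g a) = t a := by
    refine mul_right_cancel₀ ha.ne' ?_
    linear_combination hcr - hsum
  refine ⟨x, fun i hi => ?_⟩
  rw [← image_orderEmbOfFin hS, Finset.mem_image] at hi
  obtain ⟨p, -, rfl⟩ := hi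
  rw [below_orderEmbOfFin, one_mul]
  rcases Fin.eq_self_or_eq_succAbove a p with rfl | ⟨c, rfl⟩
  · rw [hxa]
    exact ht _
  · rw [hx', ← mul_assoc, sq_sign, one_mul]
    exact ht _

lemma exists_exchange {k n : ℕ} {V : Submodule ℝ (Fin n → ℝ)} (hV : Module.finrank ℝ V = k)
    {I J : Finset (Fin n)} (hI : I.card = k) (hIb : vanishing V I = ⊥) (hJb : vanishing V J = ⊥)
    {i : Fin n} (hi : i ∈ I) (hiJ : i ∉ J) :
    ∃ j ∈ J, j ∉ I ∧ vanishing V (insert j (I.erase i)) = ⊥ := by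
  have hc := Finset.card_erase_add_one hi
  obtain ⟨v, hv, hv0, hvI⟩ := exists_mem_vanishing (V := V) (R := I.erase i) (by omega)
  obtain ⟨j, hj, hvj⟩ : ∃ j ∈ J, v j ≠ 0 := by
    by_contra! hall
    have : v ∈ vanishing V J := ⟨hv, hall⟩
    rw [hJb] at this
    exact hv0 this
  have hvanish : ∀ u ∈ V, (∀ x ∈ I.erase i, u x = 0) → u i = 0 → u = 0 := by
    intro u hu h1 h2
    have : u ∈ vanishing V I := ⟨hu, fun x hx => by
      by_cases hxi : x = i
      · rwa [hxi]
      · exact h1 x (Finset.mem_erase.2 ⟨hxi, hx⟩)⟩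
    rwa [hIb] at this
  have hvi : v i ≠ 0 := fun h => hv0 (hvanish v hv hvI h)
  refine ⟨j, hj, fun hjI => ?_, ?_⟩
  · exact hvj (hvI j (Finset.mem_erase.2 ⟨by rintro rfl; exact hiJ hj, hjI⟩))
  · rw [Submodule.eq_bot_iff]
    rintro u ⟨hu, hu0⟩
    have h1 : u - (u i / v i) • v = 0 := by
      refine hvanish _ (V.sub_mem hu (V.smul_mem _ hv)) (fun x hx => ?_) ?_
      · simp [hu0 x (Finset.mem_insert_of_mem hx), hvI x hx]
      · simp [hvi]
    have h2 := congrFun h1 j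
    have h3 : u i / v i = 0 := by
      simpa [hu0 j (Finset.mem_insert_self _ _), hvj, hvi] using h2
    rwa [h3, zero_smul, sub_zero] at h1

lemma pluck_mul_pos {k n : ℕ} {C : Matrix (Fin k) (Fin n) ℝ}
    (hC : LinearIndependent ℝ fun i => C i)
    (hb : ∀ (x : Fin k → ℝ) (S : Finset (Fin n)), S.card = k + 1 →
      ¬ Alternates (Matrix.vecMul x C) S 1)
    {I J : Finset (Fin n)} (hI : I.card = k) (hJ : J.card = k) (hpI : pluck C I hI ≠ 0)
    (hpJ : pluck C J hJ ≠ 0) : 0 < pluck C I hI * pluck C J hJ := by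
  induction hr : (I \ J).card generalizing I with
  | zero =>
    rw [Finset.card_eq_zero, Finset.sdiff_eq_empty_iff_subset] at hr
    obtain rfl := Finset.eq_of_subset_of_card_le hr (by omega)
    exact mul_self_pos.2 hpI
  | succ r ih =>
    obtain ⟨i, hi⟩ := Finset.card_pos.1 (by omega : 0 < (I \ J).card)
    obtain ⟨hiI, hiJ⟩ := Finset.mem_sdiff.1 hi
    have hV : Module.finrank ℝ (Submodule.span ℝ (Set.range fun i => C i)) = k := by
      rw [finrank_span_eq_card hC, Fintype.card_fin]
    obtain ⟨j, hjJ, hjI, hbot⟩ := exists_exchange hV hI ((pluck_ne_zero_iff hC hI).1 hpI)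
      ((pluck_ne_zero_iff hC hJ).1 hpJ) hiI hiJ
    have hS : (insert j I).card = k + 1 := by rw [Finset.card_insert_of_notMem hjI, hI]
    have hji : j ≠ i := by rintro rfl; exact hiJ hjJ
    have hK : (insert j (I.erase i)).card = k := by
      rw [Finset.card_insert_of_notMem (by simp [hjI]), Finset.card_erase_add_one hiI, hI]
    have hpK : pluck C _ hK ≠ 0 := (pluck_ne_zero_iff hC hK).2 hbot
    have h1 : (insert j I).erase j = I := Finset.erase_insert hjI
    have h2 : (insert j I).erase i = insert j (I.erase i) := Finset.erase_insert_of_ne hji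
    obtain ⟨p, hp⟩ := exists_pluck_erase C hS (Finset.mem_insert_self j I) (by rw [h1, hI])
    obtain ⟨q, hq⟩ := exists_pluck_erase C hS (Finset.mem_insert_of_mem hiI) (by rw [h2, hK])
    simp only [h1] at hp
    simp only [h2] at hq
    have hIK : 0 < pluck C I hI * pluck C _ hK := by
      by_contra hle
      rcases mul_neg_iff.1 (lt_of_le_of_ne (not_lt.1 hle) (mul_ne_zero hpI hpK)) with h | h
      · obtain ⟨x, hx⟩ := exists_alternates_of_minors hS (hp ▸ h.1) (hq ▸ h.2)
        exact hb x _ hS hx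
      · obtain ⟨x, hx⟩ := exists_alternates_of_minors hS (hq ▸ h.2) (hp ▸ h.1)
        exact hb x _ hS hx
    have hsdiff : (insert j (I.erase i) \ J) = (I \ J).erase i := by
      rw [Finset.insert_sdiff_of_mem _ hjJ, Finset.erase_sdiff_comm]
    have hKJ := ih hK hpK (by rw [hsdiff, Finset.card_erase_of_mem hi, hr, Nat.add_sub_cancel])
    refine pos_of_mul_pos_left (b := pluck C _ hK ^ 2) ?_ (sq_nonneg _)
    linarith [mul_pos hIK hKJ]

lemma totNonneg_of_not_alternates {k n : ℕ} (hk : 0 < k) {V : Submodule ℝ (Fin n → ℝ)}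
    (hV : Module.finrank ℝ V = k)
    (hb : ∀ v ∈ V, ∀ S : Finset (Fin n), S.card = k + 1 → ∀ σ, ¬ Alternates v S σ) :
    TotNonneg k V := by
  let b := Module.finBasisOfFinrankEq ℝ V hV
  let C : Matrix (Fin k) (Fin n) ℝ := Matrix.of fun i => (b i : Fin n → ℝ)
  have hC : LinearIndependent ℝ fun i => C i :=
    b.linearIndependent.map' V.subtype V.ker_subtype
  have hspan : ∀ D : Matrix (Fin k) (Fin n) ℝ, (LinearIndependent ℝ fun i => D i) →
      (∀ i, D i ∈ V) → Submodule.span ℝ (Set.range fun i => D i) = V := by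
    intro D hD hDV
    refine Submodule.eq_of_le_of_finrank_eq (Submodule.span_le.2 ?_) ?_
    · rintro _ ⟨i, rfl⟩
      exact hDV i
    · rw [finrank_span_eq_card hD, Fintype.card_fin, hV]
  have hCV : ∀ i, C i ∈ V := fun i => (b i).2
  have hb' : ∀ (x : Fin k → ℝ) (S : Finset (Fin n)), S.card = k + 1 →
      ¬ Alternates (Matrix.vecMul x C) S 1 := fun x S hS =>
    hb _ (hspan C hC hCV ▸ (mem_span_rows_iff C _).2 ⟨x, rfl⟩) S hS 1
  by_cases hall : ∀ (S : Finset (Fin n)) (h : S.card = k), pluck C S h = 0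
  · exact ⟨C, hC, hspan C hC hCV, fun S h => (hall S h).ge⟩
  · push Not at hall
    obtain ⟨I, hI, hpI⟩ := hall
    let u : Fin k → ℝˣ := fun i => if i = ⟨0, hk⟩ then Units.mk0 _ hpI else 1
    let D : Matrix (Fin k) (Fin n) ℝ := Matrix.of fun i => u i • C i
    have hD : LinearIndependent ℝ fun i => D i := hC.units_smul u
    refine ⟨D, hD, hspan D hD fun i => V.smul_mem (u i : ℝ) (hCV i), fun S h => ?_⟩
    have hpD : pluck D S h = pluck C I hI * pluck C S h := by
      have hprod : ∏ i, (u i : ℝ) = pluck C I hI := by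
        rw [Finset.prod_eq_single_of_mem ⟨0, hk⟩ (Finset.mem_univ _)]
        · simp [u]
        · intro i _ hi
          simp [u, hi]
      rw [← hprod]
      exact Matrix.det_mul_column (fun i => (u i : ℝ)) _
    rw [hpD]
    by_cases hpS : pluck C S h = 0
    · rw [hpS, mul_zero]
    · exact (pluck_mul_pos hC hb' hI h hpI hpS).le

/-- Gantmakher–Krein: characterization of the totally nonnegative
Grassmannian by sign variation. -/
theorem stmt0 (k n : ℕ) (hk : 0 < k) (hkn : k < n)
    (V : Submodule ℝ (Fin n → ℝ)) (hV : Module.finrank ℝ V = k)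
    (W : Submodule ℝ (Fin n → ℝ))
    (hW : ∀ w : Fin n → ℝ, w ∈ W ↔ ∀ v ∈ V, ∑ i, v i * w i = 0) :
    (TotNonneg k V ↔ ∀ v : Fin n → ℝ, v ∈ V → signChanges v ≤ k - 1) ∧
    (TotNonneg k V ↔ ∀ w : Fin n → ℝ, w ∈ W → w ≠ 0 → k ≤ varBar w) := by
  have hab : TotNonneg k V ↔ ∀ v : Fin n → ℝ, v ∈ V → signChanges v ≤ k - 1 := by
    constructor
    · intro h v hv
      by_contra hlt
      obtain ⟨S, hS, σ, hσ⟩ := (le_signChanges_iff hk v).1 (by omega)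
      exact h.not_alternates hV hv hS σ hσ
    · intro h
      refine totNonneg_of_not_alternates hk hV fun v hv S hS σ hσ => ?_
      have h1 := (le_signChanges_iff hk v).2 ⟨S, hS, σ, hσ⟩
      have h2 := h v hv
      omega
  exact ⟨hab, hab.trans (IsPerp.forall_signChanges_iff hW hk hkn hV)⟩
end
end

section
/- Fix 0 < k ≤ n. For every collection M of k-element subsets of [n] such that S_M is nonempty, the set S_M, with the subspace topology induced from the Grassmannian Gr_{k,n}, is homeomorphic to ℝ^d for some d ≥ 0; thus the decomposition Gr≥0_{k,n} = ⨆_M S_M (disjoint union over all M with S_M ≠ ∅) is a decomposition of the totally nonnegative Grassmannian into open cells. -/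
noncomputable section

/-- Full-rank `k x n` real matrices (those with linearly independent rows). -/
def FullRk (k n : ℕ) : Type :=
  {C : Matrix (Fin k) (Fin n) ℝ // LinearIndependent ℝ (fun i => C i)}

instance (k n : ℕ) : TopologicalSpace (FullRk k n) :=
  inferInstanceAs (TopologicalSpace
    {C : Matrix (Fin k) (Fin n) ℝ // LinearIndependent ℝ (fun i => C i)})

/-- Two full-rank matrices are equivalent iff they have the same row span. -/
def grSetoid (k n : ℕ) : Setoid (FullRk k n) :=
  ⟨fun C D => Submodule.span ℝ (Set.range (fun i => C.1 i)) =
      Submodule.span ℝ (Set.range (fun i => D.1 i)),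
    ⟨fun _ => rfl, fun h => h.symm, fun h1 h2 => h1.trans h2⟩⟩

/-- The real Grassmannian `Gr_{k,n}`: full-rank `k x n` matrices modulo row
operations, equipped with the quotient topology. -/
def Gr (k n : ℕ) : Type := Quotient (grSetoid k n)

instance (k n : ℕ) : TopologicalSpace (Gr k n) :=
  inferInstanceAs (TopologicalSpace (Quotient (grSetoid k n)))

/-- The point of `Gr k n` represented by the full-rank matrix `C`. -/
def grMk {k n : ℕ} (C : Matrix (Fin k) (Fin n) ℝ)
    (h : LinearIndependent ℝ (fun i => C i)) : Gr k n :=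
  Quotient.mk (grSetoid k n) ⟨C, h⟩

/-- The subset `S_M` of the totally nonnegative Grassmannian where exactly the
Pluecker coordinates indexed by `M` are positive (and all others vanish). -/
def SMset (k n : ℕ) (M : Set (Finset (Fin n))) : Set (Gr k n) :=
  {P | ∃ (C : Matrix (Fin k) (Fin n) ℝ)
      (hC : LinearIndependent ℝ (fun i => C i)),
      grMk C hC = P ∧
      (∀ (S : Finset (Fin n)) (h : S.card = k), 0 ≤ pluck C S h) ∧
      (∀ (S : Finset (Fin n)) (h : S.card = k), (0 < pluck C S h ↔ S ∈ M))}

namespace Positroid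

open Finset

variable {k n : ℕ}

/-- The maximal minor on the columns `S`, extended by `0` to sets of the wrong size. -/
def minor (C : Matrix (Fin k) (Fin n) ℝ) (S : Finset (Fin n)) : ℝ :=
  if h : S.card = k then pluck C S h else 0

theorem minor_eq_pluck (C : Matrix (Fin k) (Fin n) ℝ) (S : Finset (Fin n)) (h : S.card = k) :
    minor C S = pluck C S h := dif_pos h

theorem card_of_minor_ne_zero {C : Matrix (Fin k) (Fin n) ℝ} {S : Finset (Fin n)}
    (h : minor C S ≠ 0) : S.card = k := by
  by_contra hS
  exact h (dif_neg hS)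

theorem pluck_eq_det (C : Matrix (Fin k) (Fin n) ℝ) (S : Finset (Fin n)) (h : S.card = k) :
    pluck C S h = (C.submatrix id (S.orderEmbOfFin h)).det := rfl

/-- The wedge product of the columns in `S`, in increasing order. -/
def wedge (C : Matrix (Fin k) (Fin n) ℝ) (S : Finset (Fin n)) :
    ExteriorAlgebra ℝ (Fin k → ℝ) :=
  ((S.sort (· ≤ ·)).map fun s => ExteriorAlgebra.ι ℝ (C.col s)).prod

/-- The determinant, as a linear functional on the exterior algebra. -/
def topForm (k : ℕ) : ExteriorAlgebra ℝ (Fin k → ℝ) →ₗ[ℝ] ℝ :=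
  ExteriorAlgebra.liftAlternating (Pi.single k Matrix.detRowAlternating)

theorem topForm_wedge (C : Matrix (Fin k) (Fin n) ℝ) (S : Finset (Fin n)) :
    topForm k (wedge C S) = minor C S := by
  have hw : ∀ (m : ℕ) (hm : S.card = m), wedge C S =
      ExteriorAlgebra.ιMulti ℝ m (fun t => C.col (S.orderEmbOfFin hm t)) := by
    rintro m rfl
    rw [ExteriorAlgebra.ιMulti_apply, wedge]
    congr 1
    apply List.ext_getElem
    · simp
    · intro i h1 h2
      simp [Finset.orderEmbOfFin_apply]
  by_cases h : S.card = k
  · rw [hw k h, topForm, ExteriorAlgebra.liftAlternating_apply_ιMulti, Pi.single_eq_same,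
      minor_eq_pluck _ _ h, pluck_eq_det, ← Matrix.det_transpose]
    rfl
  · rw [hw _ rfl, topForm, ExteriorAlgebra.liftAlternating_apply_ιMulti, Pi.single_eq_of_ne h,
      minor, dif_neg h]
    rfl

/-- The sign of moving `x` past the elements of `R` smaller than `x`. -/
def insertSign (R : Finset (Fin n)) (x : Fin n) : ℝ := (-1) ^ (R.filter (· < x)).card

theorem insertSign_mul_self (R : Finset (Fin n)) (x : Fin n) :
    insertSign R x * insertSign R x = 1 := by
  rw [insertSign, ← mul_pow]; simp

theorem insertSign_insert_lt {R : Finset (Fin n)} {w x : Fin n} (hw : w ∉ R) (h : w < x) :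
    insertSign (insert w R) x = - insertSign R x := by
  rw [insertSign, insertSign, filter_insert, if_pos h, card_insert_of_notMem (by simp [hw]),
    pow_succ]
  ring

theorem insertSign_insert_ge {R : Finset (Fin n)} {w x : Fin n} (h : x ≤ w) :
    insertSign (insert w R) x = insertSign R x := by
  rw [insertSign, insertSign, filter_insert, if_neg (not_lt.mpr h)]

theorem wedge_insert_of_lt (C : Matrix (Fin k) (Fin n) ℝ) {S : Finset (Fin n)} {m : Fin n}
    (h : ∀ x ∈ S, m < x) : wedge C (insert m S) = ExteriorAlgebra.ι ℝ (C.col m) * wedge C S := by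
  rw [wedge, sort_insert (· ≤ ·) (fun b hb => (h b hb).le) (fun hm => lt_irrefl _ (h m hm))]
  simp [wedge]

theorem ι_mul_wedge (C : Matrix (Fin k) (Fin n) ℝ) (S : Finset (Fin n)) (x : Fin n)
    (hx : x ∉ S) : ExteriorAlgebra.ι ℝ (C.col x) * wedge C S =
      insertSign S x • wedge C (insert x S) := by
  induction S using Finset.induction_on_min with
  | empty => rw [← wedge_insert_of_lt C (by simp)]; simp [insertSign]
  | insert m S hm ih =>
    have hmS : m ∉ S := fun h => lt_irrefl _ (hm m h)
    simp only [mem_insert, not_or] at hx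
    rcases lt_or_gt_of_ne hx.1 with h | h
    · rw [← wedge_insert_of_lt C]
      · have : (insert m S).filter (· < x) = ∅ := by
          ext y
          simp only [mem_filter, mem_insert, notMem_empty, iff_false, not_and, not_lt]
          rintro (rfl | hy)
          · exact h.le
          · exact (h.trans (hm y hy)).le
        simp [insertSign, this]
      · intro y hy
        rcases mem_insert.mp hy with rfl | hy
        · exact h
        · exact h.trans (hm y hy)
    · rw [wedge_insert_of_lt C hm, ← mul_assoc,
        eq_neg_of_add_eq_zero_left (ExteriorAlgebra.ι_add_mul_swap (R := ℝ) (C.col x) (C.col m)),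
        neg_mul, mul_assoc, ih hx.2, mul_smul_comm, ← wedge_insert_of_lt C,
        insertSign_insert_lt hmS h, neg_smul, Finset.insert_comm]
      intro y hy
      rcases mem_insert.mp hy with rfl | hy
      · exact h
      · exact hm y hy

theorem ι_mul_wedge_of_mem (C : Matrix (Fin k) (Fin n) ℝ) (S : Finset (Fin n)) (x : Fin n)
    (hx : x ∈ S) : ExteriorAlgebra.ι ℝ (C.col x) * wedge C S = 0 := by
  have h := ι_mul_wedge C (S.erase x) x (by simp)
  rw [insert_erase hx] at h
  have h2 : wedge C S = insertSign (S.erase x) x •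
      (ExteriorAlgebra.ι ℝ (C.col x) * wedge C (S.erase x)) := by
    rw [h, smul_smul, insertSign_mul_self, one_smul]
  rw [h2, mul_smul_comm, ← mul_assoc, ExteriorAlgebra.ι_sq_zero, zero_mul, smul_zero]

theorem wedge_updateCol_of_notMem (C : Matrix (Fin k) (Fin n) ℝ) {S : Finset (Fin n)} {s : Fin n}
    (hs : s ∉ S) (v : Fin k → ℝ) : wedge (C.updateCol s v) S = wedge C S := by
  unfold wedge
  congr 1
  apply List.map_congr_left
  intro t ht
  have : t ≠ s := fun h => hs (by simpa [h] using ht)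
  congr 1
  ext r
  simp [Matrix.col, this]

theorem minor_updateCol_of_notMem (C : Matrix (Fin k) (Fin n) ℝ) {S : Finset (Fin n)} {s : Fin n}
    (hs : s ∉ S) (v : Fin k → ℝ) : minor (C.updateCol s v) S = minor C S := by
  rw [← topForm_wedge, ← topForm_wedge, wedge_updateCol_of_notMem C hs]

theorem minor_updateCol (C : Matrix (Fin k) (Fin n) ℝ) {S : Finset (Fin n)} {s : Fin n}
    (hs : s ∈ S) (v : Fin k → ℝ) : minor (C.updateCol s v) S =
      insertSign (S.erase s) s *
        topForm k (ExteriorAlgebra.ι ℝ v * wedge C (S.erase s)) := by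
  have h := ι_mul_wedge (C.updateCol s v) (S.erase s) s (by simp)
  rw [insert_erase hs, wedge_updateCol_of_notMem _ (by simp)] at h
  have hv : (C.updateCol s v).col s = v := by ext r; simp [Matrix.col]
  rw [hv] at h
  rw [h, map_smul, smul_eq_mul, ← mul_assoc, insertSign_mul_self, one_mul, topForm_wedge]

theorem minor_updateCol_col (C : Matrix (Fin k) (Fin n) ℝ) {S : Finset (Fin n)} {s y : Fin n}
    (hs : s ∈ S) (hy : y ∉ S.erase s) : minor (C.updateCol s (C.col y)) S =
      insertSign (S.erase s) s * insertSign (S.erase s) y * minor C (insert y (S.erase s)) := by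
  rw [minor_updateCol C hs, ι_mul_wedge C _ _ hy, map_smul, topForm_wedge, smul_eq_mul, mul_assoc]

theorem minor_updateCol_col_of_mem (C : Matrix (Fin k) (Fin n) ℝ) {S : Finset (Fin n)}
    {s y : Fin n} (hs : s ∈ S) (hy : y ∈ S.erase s) :
    minor (C.updateCol s (C.col y)) S = 0 := by
  rw [minor_updateCol C hs, ι_mul_wedge_of_mem C _ _ hy, map_zero, mul_zero]

/-- The minor on `S` as a linear function of the column `s`. -/
def minorCol (C : Matrix (Fin k) (Fin n) ℝ) (S : Finset (Fin n)) (s : Fin n) :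
    (Fin k → ℝ) →ₗ[ℝ] ℝ :=
  insertSign (S.erase s) s • (topForm k ∘ₗ
    (LinearMap.mulRight ℝ (wedge C (S.erase s))) ∘ₗ ExteriorAlgebra.ι ℝ)

theorem minorCol_apply (C : Matrix (Fin k) (Fin n) ℝ) {S : Finset (Fin n)} {s : Fin n}
    (hs : s ∈ S) (v : Fin k → ℝ) : minorCol C S s v = minor (C.updateCol s v) S := by
  rw [minor_updateCol C hs]; rfl

theorem minorCol_col_self (C : Matrix (Fin k) (Fin n) ℝ) {S : Finset (Fin n)} {s : Fin n}
    (hs : s ∈ S) : minorCol C S s (C.col s) = minor C S := by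
  rw [minorCol_apply C hs]
  congr 1
  ext a b
  by_cases h : b = s <;> simp [h, Matrix.col]

/-- Cramer's rule for the columns of a matrix. -/
theorem minor_smul_eq_sum (C : Matrix (Fin k) (Fin n) ℝ) (S : Finset (Fin n)) (hS : S.card = k)
    (v : Fin k → ℝ) : minor C S • v = ∑ s ∈ S, minorCol C S s v • C.col s := by
  have h := Matrix.mulVec_cramer (C.submatrix id (S.orderEmbOfFin hS)) v
  rw [minor_eq_pluck C S hS, pluck_eq_det, ← h]
  have himg : S = Finset.univ.map (S.orderEmbOfFin hS).toEmbedding := by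
    ext x
    simp
  have hc : ∀ c, minorCol C S (S.orderEmbOfFin hS c) v =
      Matrix.cramer (C.submatrix id (S.orderEmbOfFin hS)) v c := by
    intro c
    rw [minorCol_apply C (S.orderEmbOfFin_mem hS c), minor_eq_pluck _ S hS, pluck_eq_det,
      Matrix.cramer_apply]
    congr 1
    ext a b
    by_cases hb : b = c <;> simp [hb]
  conv_rhs => rw [himg, Finset.sum_map]
  rw [Matrix.mulVec_eq_sum]
  refine Finset.sum_congr rfl fun c _ => ?_
  rw [← himg, ← hc, op_smul_eq_smul]
  rfl

/-- The Grassmann-Pluecker exchange relation. -/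
theorem minor_mul_minor (C : Matrix (Fin k) (Fin n) ℝ) (S S' : Finset (Fin n)) (hS : S.card = k)
    {y : Fin n} (hy : y ∈ S') : minor C S * minor C S' =
      ∑ s ∈ S, minor (C.updateCol s (C.col y)) S * minor (C.updateCol y (C.col s)) S' := by
  have h := congrArg (minorCol C S' y) (minor_smul_eq_sum C S hS (C.col y))
  rw [map_smul, minorCol_col_self C hy, map_sum, smul_eq_mul] at h
  rw [h]
  refine Finset.sum_congr rfl fun s hs => ?_
  rw [map_smul, smul_eq_mul, minorCol_apply C hs, minorCol_apply C hy]

theorem exists_exchange (C : Matrix (Fin k) (Fin n) ℝ) {S S' : Finset (Fin n)}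
    (hS : minor C S ≠ 0) (hS' : minor C S' ≠ 0) {y : Fin n} (hy : y ∈ S') (hyS : y ∉ S) :
    ∃ s ∈ S, s ∉ S' ∧ minor C (insert y (S.erase s)) ≠ 0 ∧
      minor C (insert s (S'.erase y)) ≠ 0 := by
  have h := minor_mul_minor C S S' (card_of_minor_ne_zero hS) hy
  obtain ⟨s, hs, hne⟩ := Finset.exists_ne_zero_of_sum_ne_zero (h ▸ mul_ne_zero hS hS')
  have hsy : s ≠ y := fun e => hyS (e ▸ hs)
  have hs' : s ∉ S'.erase y := fun hmem => by
    rw [minor_updateCol_col_of_mem C hy hmem, mul_zero] at hne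
    exact hne rfl
  rw [minor_updateCol_col C hs (by simp [hyS]), minor_updateCol_col C hy hs'] at hne
  refine ⟨s, hs, by simpa [hsy] using hs', fun h0 => hne ?_, fun h0 => hne ?_⟩ <;> simp [h0]

/-- The three-term Pluecker relation for sorted minors. -/
theorem minor_three_term (C : Matrix (Fin k) (Fin n) ℝ) {L : Finset (Fin n)} {w x y z : Fin n}
    (hwx : w < x) (hxy : x < y) (hyz : y < z) (hw : w ∉ L) (hx : x ∉ L) (hy : y ∉ L) (hz : z ∉ L) :
    minor C (insert w (insert y L)) * minor C (insert x (insert z L)) =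
      minor C (insert w (insert x L)) * minor C (insert y (insert z L)) +
        minor C (insert w (insert z L)) * minor C (insert x (insert y L)) := by
  by_cases hc : L.card + 2 = k
  swap
  · have h0 : ∀ a b, a < b → a ∉ L → b ∉ L → minor C (insert a (insert b L)) = 0 := by
      intro a b hab ha hb
      apply dif_neg
      rw [card_insert_of_notMem (by simp [ha, hab.ne]), card_insert_of_notMem hb]
      omega
    rw [h0 w y (hwx.trans hxy) hw hy, h0 w x hwx hw hx, h0 w z (hwx.trans (hxy.trans hyz)) hw hz]
    ring
  have hwy := hwx.trans hxy
  have hxz := hxy.trans hyz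
  have hwz := hwy.trans hyz
  have hcard : (insert w (insert x L)).card = k := by
    rw [card_insert_of_notMem (by simp [hw, hwx.ne]), card_insert_of_notMem hx]
    omega
  have h := minor_mul_minor C (insert w (insert x L)) (insert y (insert z L)) hcard
    (mem_insert_self y _)
  rw [sum_insert (by simp [hw, hwx.ne]), sum_insert hx,
    sum_eq_zero (s := L), add_zero] at h
  swap
  · intro s hs
    have : s ≠ y := fun e => hy (e ▸ hs)
    rw [minor_updateCol_col_of_mem C (S := insert y (insert z L)) (mem_insert_self y _)
      (by simp [hs, this]), mul_zero]
  have e1 : (insert w (insert x L)).erase w = insert x L := by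
    rw [erase_insert]; simp [hw, hwx.ne]
  have e2 : (insert w (insert x L)).erase x = insert w L := by
    rw [Finset.insert_comm, erase_insert]; simp [hx, hwx.ne']
  have e3 : (insert y (insert z L)).erase y = insert z L := by
    rw [erase_insert]; simp [hy, hyz.ne]
  rw [minor_updateCol_col C (mem_insert_self w _) (by rw [e1]; simp [hy, hxy.ne']),
    minor_updateCol_col C (mem_insert_self y _) (by rw [e3]; simp [hw, hwz.ne]),
    minor_updateCol_col C (S := insert w (insert x L)) (s := x) (by simp)
      (by rw [e2]; simp [hy, hwy.ne']),
    minor_updateCol_col C (mem_insert_self y _) (by rw [e3]; simp [hx, hxz.ne]), e1, e2, e3,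
    insertSign_insert_ge hwx.le, insertSign_insert_lt hx hxy, insertSign_insert_ge hyz.le,
    insertSign_insert_ge hwz.le, insertSign_insert_lt hw hwx, insertSign_insert_lt hw hwy,
    insertSign_insert_ge hxz.le, Finset.insert_comm y x, Finset.insert_comm y w] at h
  have sw := insertSign_mul_self L w
  have sx := insertSign_mul_self L x
  have sy := insertSign_mul_self L y
  linear_combination (-1 : ℝ) * h +
    (minor C (insert x (insert y L)) * minor C (insert w (insert z L)) *
      (insertSign L w ^ 2 * sy + sw) -
    minor C (insert w (insert y L)) * minor C (insert x (insert z L)) *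
      (insertSign L x ^ 2 * sy + sx))

theorem minor_mul (g : Matrix (Fin k) (Fin k) ℝ) (C : Matrix (Fin k) (Fin n) ℝ)
    (S : Finset (Fin n)) : minor (g * C) S = g.det * minor C S := by
  by_cases h : S.card = k
  · rw [minor_eq_pluck _ _ h, minor_eq_pluck _ _ h, pluck_eq_det, pluck_eq_det, ← Matrix.det_mul]
    rfl
  · simp [minor, h]

/-- Nonnegative functions with support `M` satisfying the three-term Pluecker relations. -/
structure IsPlucker (M : Set (Finset (Fin n))) (p : Finset (Fin n) → ℝ) : Prop where
  nonneg : ∀ S, 0 ≤ p S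
  pos_iff : ∀ S, 0 < p S ↔ S ∈ M
  three_term : ∀ {L : Finset (Fin n)} {w x y z : Fin n}, w < x → x < y → y < z →
    w ∉ L → x ∉ L → y ∉ L → z ∉ L →
    p (insert w (insert y L)) * p (insert x (insert z L)) =
      p (insert w (insert x L)) * p (insert y (insert z L)) +
        p (insert w (insert z L)) * p (insert x (insert y L))

/-- The symmetric exchange property. -/
def Exchange (M : Set (Finset (Fin n))) : Prop :=
  ∀ S ∈ M, ∀ S' ∈ M, ∀ y ∈ S', y ∉ S →
    ∃ s ∈ S, s ∉ S' ∧ insert y (S.erase s) ∈ M ∧ insert s (S'.erase y) ∈ M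

/-- Position of `e` in the cyclic order starting at `i`. -/
def cyclicPos (i e : Fin n) : ℕ := if e < i then e + n else e

/-- No element strictly between `i` and `j` distinguishes two members of `M`. -/
def Adjacent (M : Set (Finset (Fin n))) (i j : Fin n) : Prop :=
  i < j ∧ ∀ S ∈ M, ∀ S' ∈ M, ∀ e ∈ S, e ∉ S' → i < e → ¬ e < j

namespace IsPlucker

variable {M : Set (Finset (Fin n))} {p : Finset (Fin n) → ℝ}

theorem eq_zero_iff (hp : IsPlucker M p) (S : Finset (Fin n)) : p S = 0 ↔ S ∉ M := by
  rw [← hp.pos_iff, not_lt]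
  exact ⟨fun h => h.le, fun h => le_antisymm h (hp.nonneg S)⟩

theorem cyclic_three_term (hp : IsPlucker M p) {L : Finset (Fin n)} {i j a b : Fin n}
    (hij : i < j) (hi : i ∉ L) (hj : j ∉ L) (ha : a ∉ L) (hb : b ∉ L)
    (h : (j < a ∧ a < b) ∨ (a < b ∧ b < i) ∨ (b < i ∧ j < a)) :
    p (insert i (insert a L)) * p (insert j (insert b L)) =
      p (insert i (insert b L)) * p (insert j (insert a L)) +
        p (insert i (insert j L)) * p (insert a (insert b L)) := by
  rcases h with ⟨h1, h2⟩ | ⟨h1, h2⟩ | ⟨h1, h2⟩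
  · rw [hp.three_term hij h1 h2 hi hj ha hb]; ring
  · have := hp.three_term h1 h2 hij ha hb hi hj
    rw [Finset.insert_comm i a, Finset.insert_comm j b, Finset.insert_comm i b,
      Finset.insert_comm j a, this]; ring
  · have := hp.three_term h1 hij h2 hb hi hj ha
    rw [Finset.insert_comm j b, Finset.insert_comm i b, Finset.insert_comm a b]
    linear_combination this

end IsPlucker

theorem cyclicPos_lt {i j a b : Fin n} (ha : a ≤ i → a < i)
    (hb : b ≤ i → b < i) (ha' : i < a → j < a) (hb' : i < b → j < b)
    (h : cyclicPos i a < cyclicPos i b) :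
    (j < a ∧ a < b) ∨ (a < b ∧ b < i) ∨ (b < i ∧ j < a) := by
  unfold cyclicPos at h
  simp only [Fin.lt_def, Fin.le_def] at *
  have := a.2
  have := b.2
  split_ifs at h <;> omega

theorem cyclicPos_injective (i : Fin n) : Function.Injective (cyclicPos i) := by
  intro a b h
  unfold cyclicPos at h
  have := a.2
  have := b.2
  ext
  split_ifs at h <;> omega

/-- The sets to which both `i` and `j` can be added. -/
def link (M : Set (Finset (Fin n))) (i j : Fin n) : Set (Finset (Fin n)) :=
  {R | i ∉ R ∧ j ∉ R ∧ insert i R ∈ M}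

/-- `R₀` is a member of the link which comes first in the cyclic order starting at `i`. -/
def IsFirst (M : Set (Finset (Fin n))) (i j : Fin n) (R₀ : Finset (Fin n)) : Prop :=
  R₀ ∈ link M i j ∧ ∀ R ∈ link M i j, ∑ e ∈ R₀, cyclicPos i e ≤ ∑ e ∈ R, cyclicPos i e

theorem Adjacent.lt_of_lt {M : Set (Finset (Fin n))} {i j : Fin n} (h : Adjacent M i j)
    {R R' : Finset (Fin n)} (hR : R ∈ link M i j) (hR' : R' ∈ link M i j) {e : Fin n}
    (he : e ∈ R) (he' : e ∉ R') (hie : i < e) : j < e := by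
  have h1 := h.2 _ hR.2.2 _ hR'.2.2 e (mem_insert_of_mem he)
    (by simp [he', hie.ne']) hie
  exact lt_of_le_of_ne (not_lt.mp h1) (fun h2 => hR.2.1 (h2 ▸ he))

theorem sum_exchange {R : Finset (Fin n)} {a b : Fin n} (ha : a ∈ R) (hb : b ∉ R)
    (f : Fin n → ℕ) : ∑ e ∈ insert b (R.erase a), f e + f a = ∑ e ∈ R, f e + f b := by
  rw [sum_insert (by simp [hb]), ← add_sum_erase R f ha]
  ring

theorem IsFirst.exists_step {M : Set (Finset (Fin n))} (hM : Exchange M) {i j : Fin n}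
    {R₀ R : Finset (Fin n)} (h₀ : IsFirst M i j R₀) (hR : R ∈ link M i j) {a : Fin n}
    (ha : a ∈ R₀) (haR : a ∉ R) :
    ∃ b ∈ R, b ∉ R₀ ∧ insert a (R.erase b) ∈ link M i j ∧ cyclicPos i a < cyclicPos i b := by
  obtain ⟨⟨hi₀, hj₀, hm₀⟩, hmin⟩ := h₀
  obtain ⟨hi, hj, hm⟩ := hR
  have hai : a ≠ i := fun h => hi₀ (h ▸ ha)
  have haj : a ≠ j := fun h => hj₀ (h ▸ ha)
  obtain ⟨b, hb, hb₀, h1, h2⟩ := hM _ hm _ hm₀ a (mem_insert_of_mem ha) (by simp [haR, hai])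
  simp only [mem_insert, not_or] at hb hb₀
  have hbR : b ∈ R := hb.resolve_left hb₀.1
  have hbj : b ≠ j := fun h => hj (h ▸ hbR)
  rw [erase_insert_of_ne (Ne.symm hb₀.1), Finset.insert_comm] at h1
  rw [erase_insert_of_ne (Ne.symm hai), Finset.insert_comm] at h2
  refine ⟨b, hbR, hb₀.2, ⟨by simp [hi, hai.symm], by simp [hj, haj.symm], h1⟩, ?_⟩
  have hle := hmin _ ⟨by simp [hi₀, Ne.symm hb₀.1], by simp [hj₀, hbj.symm], h2⟩
  have hs := sum_exchange ha hb₀.2 (cyclicPos i)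
  refine lt_of_le_of_ne (by omega) fun h => ?_
  exact haR (cyclicPos_injective i h ▸ hbR)

/-- The ratio `p (R ∪ j) / p (R ∪ i)` is minimal at the first member of the link, and
whether the minimum is attained at `R` depends on the support only. -/
theorem exists_ratio_eq_iff {M : Set (Finset (Fin n))} (hM : Exchange M) {i j : Fin n}
    (hij : Adjacent M i j) {R₀ : Finset (Fin n)} (h₀ : IsFirst M i j R₀) (R : Finset (Fin n))
    (hR : R ∈ link M i j) (hcard : R.card = R₀.card) : ∃ Q : Prop, ∀ p, IsPlucker M p →
      p (insert i R) * p (insert j R₀) ≤ p (insert i R₀) * p (insert j R) ∧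
      (p (insert i R₀) * p (insert j R) = p (insert i R) * p (insert j R₀) ↔ Q) := by
  induction hd : (R₀ \ R).card generalizing R with
  | zero =>
    have : R₀ = R := eq_of_subset_of_card_le
      (sdiff_eq_empty_iff_subset.mp (card_eq_zero.mp hd)) hcard.le
    subst this
    exact ⟨True, fun p _ => ⟨le_rfl, by simp⟩⟩
  | succ d ih =>
    obtain ⟨a, ha⟩ : (R₀ \ R).Nonempty := card_pos.mp (by omega)
    rw [mem_sdiff] at ha
    obtain ⟨b, hb, hb₀, hR₁, hab⟩ := h₀.exists_step hM hR ha.1 ha.2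
    set L := R.erase b with hL
    have hbL : insert b L = R := insert_erase hb
    have hcard₁ : (insert a L).card = R.card := by
      rw [← hbL, card_insert_of_notMem (by simp [hL, ha.2]),
        card_insert_of_notMem (by simp [hL])]
    have hd₁ : (R₀ \ insert a L).card = d := by
      have : R₀ \ insert a L = (R₀ \ R).erase a := by
        ext x
        simp only [mem_sdiff, mem_insert, mem_erase, hL, not_or]
        constructor
        · rintro ⟨hx, hxa, h⟩
          exact ⟨hxa, hx, fun hxR => h ⟨fun e => hb₀ (e ▸ hx), hxR⟩⟩
        · rintro ⟨hxa, hx, h⟩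
          exact ⟨hx, hxa, fun h' => h h'.2⟩
      rw [this, card_erase_of_mem (mem_sdiff.mpr ha), hd]
      rfl
    obtain ⟨Q, hQ⟩ := ih (insert a L) hR₁ (hcard₁.trans hcard) hd₁
    refine ⟨Q ∧ ¬ (insert i (insert j L) ∈ M ∧ insert a (insert b L) ∈ M), fun p hp => ?_⟩
    obtain ⟨hle, heq⟩ := hQ p hp
    have hai : a ≠ i := fun h => h₀.1.1 (h ▸ ha.1)
    have hbi : b ≠ i := fun h => hR.1 (h ▸ hb)
    have h3 := hp.cyclic_three_term (L := L) (a := a) (b := b) hij.1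
      (by simp [hL, hR.1]) (by simp [hL, hR.2.1]) (by simp [hL, ha.2]) (by simp [hL])
      (cyclicPos_lt (fun h => lt_of_le_of_ne h hai) (fun h => lt_of_le_of_ne h hbi)
        (fun h => hij.lt_of_lt h₀.1 hR ha.1 ha.2 h)
        (fun h => hij.lt_of_lt hR h₀.1 hb hb₀ h) hab)
    rw [hbL] at h3 ⊢
    have hiR := (hp.pos_iff _).mpr hR.2.2
    have hiR₀ := (hp.pos_iff _).mpr h₀.1.2.2
    have hiR₁ := (hp.pos_iff _).mpr hR₁.2.2
    have hn1 := hp.nonneg (insert i (insert j L))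
    have hn2 := hp.nonneg (insert a R)
    have key : p (insert i (insert a L)) *
        (p (insert i R₀) * p (insert j R) - p (insert i R) * p (insert j R₀)) =
        p (insert i R) * (p (insert i R₀) * p (insert j (insert a L)) -
          p (insert i (insert a L)) * p (insert j R₀)) +
        p (insert i R₀) * (p (insert i (insert j L)) * p (insert a R)) := by
      linear_combination p (insert i R₀) * h3
    have t1 : 0 ≤ p (insert i R) * (p (insert i R₀) * p (insert j (insert a L)) -
          p (insert i (insert a L)) * p (insert j R₀)) :=
      mul_nonneg hiR.le (sub_nonneg.mpr hle)
    have t2 : 0 ≤ p (insert i R₀) * (p (insert i (insert j L)) * p (insert a R)) := by positivity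
    refine ⟨?_, ?_⟩
    · have := nonneg_of_mul_nonneg_right (key ▸ add_nonneg t1 t2) hiR₁
      linarith
    · rw [← sub_eq_zero, ← mul_eq_zero_iff_left hiR₁.ne', key, add_eq_zero_iff_of_nonneg t1 t2,
        mul_eq_zero_iff_left hiR.ne', sub_eq_zero, heq, mul_eq_zero_iff_left hiR₀.ne',
        mul_eq_zero, hp.eq_zero_iff, hp.eq_zero_iff, not_and_or]

theorem exists_isFirst {M : Set (Finset (Fin n))} {i j : Fin n} {R : Finset (Fin n)}
    (hR : R ∈ link M i j) : ∃ R₀, IsFirst M i j R₀ := by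
  classical
  obtain ⟨R₀, h₀, hmin⟩ := Finset.exists_min_image (univ.filter (· ∈ link M i j))
    (fun R => ∑ e ∈ R, cyclicPos i e) ⟨R, by simpa using hR⟩
  exact ⟨R₀, by simpa using h₀, fun R' hR' => hmin R' (by simpa using hR')⟩

/-- Unless `M` has only one member, there is a pair `i < j` at which a bridge can be removed. -/
theorem exists_bridge {M : Set (Finset (Fin n))} (hM : Exchange M) {p : Finset (Fin n) → ℝ}
    (hp : IsPlucker M p) (hcard : ∀ S ∈ M, S.card = k) {S₀ S₁ : Finset (Fin n)} (hS₀ : S₀ ∈ M)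
    (hS₁ : S₁ ∈ M) (hne : S₀ ≠ S₁) :
    ∃ i j R₀, Adjacent M i j ∧ IsFirst M i j R₀ ∧ insert j R₀ ∈ M := by
  classical
  let Ind : Finset (Fin n) → Prop := fun X => ∃ S ∈ M, X ⊆ S
  have ind_mono : ∀ {X Y : Finset (Fin n)}, X ⊆ Y → Ind Y → Ind X :=
    fun h ⟨S, hS, hY⟩ => ⟨S, hS, h.trans hY⟩
  let E : Finset (Fin n) := univ.filter fun e => (∃ S ∈ M, e ∈ S) ∧ ∃ S ∈ M, e ∉ S
  have memE : ∀ {e S S'}, S ∈ M → e ∈ S → S' ∈ M → e ∉ S' → e ∈ E := fun hS he hS' he' =>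
    mem_filter.mpr ⟨mem_univ _, ⟨_, hS, he⟩, ⟨_, hS', he'⟩⟩
  have indE : ¬ Ind E := by
    rintro ⟨S, hS, hES⟩
    have h : ∀ T ∈ M, T = S := fun T hT => eq_of_subset_of_card_le (fun e he => by
      by_contra heS
      exact heS (hES (memE hT he hS heS))) (by rw [hcard S hS, hcard T hT])
    exact hne ((h _ hS₀).trans (h _ hS₁).symm)
  have hEne : E.Nonempty := by
    rw [nonempty_iff_ne_empty]
    intro h
    exact indE ⟨S₀, hS₀, by simp [h]⟩
  -- the last element whose tail in `E` is dependent
  let F := E.filter fun i => ¬ Ind (E.filter (i ≤ ·))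
  have hFne : F.Nonempty := by
    refine ⟨E.min' hEne, mem_filter.mpr ⟨E.min'_mem hEne, ?_⟩⟩
    rwa [filter_true_of_mem fun e he => E.min'_le e he]
  let i := F.max' hFne
  obtain ⟨hiE, hidep⟩ : i ∈ E ∧ ¬ Ind (E.filter (i ≤ ·)) := mem_filter.mp (F.max'_mem hFne)
  have hlast : ∀ e ∈ E, i < e → Ind (E.filter (e ≤ ·)) := by
    intro e he hie
    by_contra h
    exact absurd (F.le_max' e (mem_filter.mpr ⟨he, h⟩)) (not_le.mpr hie)
  have indi : Ind {i} := by
    obtain ⟨⟨S, hS, hiS⟩, -⟩ := (mem_filter.mp hiE).2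
    exact ⟨S, hS, by simpa using hiS⟩
  have tail_i : E.filter (i ≤ ·) = insert i (E.filter (i < ·)) := by
    ext e
    simp only [mem_filter, mem_insert, le_iff_eq_or_lt, and_or_left]
    constructor
    · rintro (⟨_, rfl⟩ | h)
      exacts [Or.inl rfl, Or.inr h]
    · rintro (rfl | h)
      exacts [Or.inl ⟨hiE, rfl⟩, Or.inr h]
  have hne' : (E.filter (i < ·)).Nonempty := by
    rw [nonempty_iff_ne_empty]
    intro h
    rw [tail_i, h] at hidep
    exact hidep indi
  let j := (E.filter (i < ·)).min' hne'
  obtain ⟨hjE, hij⟩ : j ∈ E ∧ i < j := mem_filter.mp (min'_mem _ hne')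
  have hjmin : ∀ e ∈ E, i < e → j ≤ e := fun e he hie => min'_le _ e (mem_filter.mpr ⟨he, hie⟩)
  have hadj : Adjacent M i j :=
    ⟨hij, fun S hS S' hS' e he he' hie => not_lt.mpr (hjmin e (memE hS he hS' he') hie)⟩
  set A := E.filter (j < ·) with hA
  have tail_j : E.filter (j ≤ ·) = insert j A := by
    ext e
    simp only [hA, mem_filter, mem_insert, le_iff_eq_or_lt, and_or_left]
    constructor
    · rintro (⟨_, h⟩ | h)
      exacts [Or.inl h.symm, Or.inr h]
    · rintro (h | h)
      exacts [Or.inl ⟨h ▸ hjE, h.symm⟩, Or.inr h]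
  have tail_ij : E.filter (i < ·) = E.filter (j ≤ ·) := by
    ext e
    simp only [mem_filter, and_congr_right_iff]
    exact fun he => ⟨hjmin e he, hij.trans_le⟩
  have indjA : Ind (insert j A) := tail_j ▸ hlast j hjE hij
  have depijA : ¬ Ind (insert i (insert j A)) := by rwa [tail_i, tail_ij, tail_j] at hidep
  have hiA : i ∉ A := fun h => (hij.trans (mem_filter.mp h).2).false
  have hjA : j ∉ A := fun h => (mem_filter.mp h).2.false
  by_cases indiA : Ind (insert i A)
  · refine ⟨i, j, ?_⟩
    obtain ⟨S, hS, hiAS⟩ := indiA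
    have hiS : i ∈ S := hiAS (mem_insert_self i A)
    have hAS : A ⊆ S := (subset_insert i A).trans hiAS
    have hjS : j ∉ S := fun h => depijA ⟨S, hS, insert_subset hiS (insert_subset h hAS)⟩
    have hSl : S.erase i ∈ link M i j := ⟨by simp, by simp [hjS], by rwa [insert_erase hiS]⟩
    obtain ⟨R₀, h₀⟩ := exists_isFirst hSl
    refine ⟨R₀, hadj, h₀, ?_⟩
    have hAR₀ : A ⊆ R₀ := by
      intro a haA
      by_contra haR₀
      have hai : a ≠ i := fun h => hiA (h ▸ haA)
      obtain ⟨b, hb, hbS, h1, -⟩ := hM _ h₀.1.2.2 _ hS a (hAS haA) (by simp [haR₀, hai])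
      have hbi : b ≠ i := fun h => hbS (h ▸ hiS)
      have hbR₀ : b ∈ R₀ := (mem_insert.mp hb).resolve_left hbi
      rw [erase_insert_of_ne hbi.symm, Finset.insert_comm] at h1
      have haj : a ≠ j := fun h => hjA (h ▸ haA)
      have hle := h₀.2 _ ⟨by simp [h₀.1.1, hai.symm], by simp [h₀.1.2.1, haj.symm], h1⟩
      have hs := sum_exchange hbR₀ haR₀ (cyclicPos i)
      have hbE : b ∈ E := memE h₀.1.2.2 hb hS hbS
      have hlt : b < i := by
        refine lt_of_le_of_ne (not_lt.mp fun h => ?_) hbi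
        refine hbS (hAS (mem_filter.mpr ⟨hbE, lt_of_le_of_ne (hjmin b hbE h) fun h' => ?_⟩))
        exact h₀.1.2.1 (h' ▸ hbR₀)
      have hia : ¬ a < i := (hij.trans (mem_filter.mp haA).2).not_gt
      have hpos : cyclicPos i a < cyclicPos i b := by
        simp only [cyclicPos, hlt, hia, if_true, if_false]
        omega
      omega
    obtain ⟨S', hS', hjAS'⟩ := indjA
    obtain ⟨b, hb, hbS', h1, -⟩ := hM _ h₀.1.2.2 _ hS' j (hjAS' (mem_insert_self j A))
      (by simp [h₀.1.2.1, hij.ne'])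
    have hbA : b ∉ A := fun h => hbS' (hjAS' (mem_insert_of_mem h))
    have hbi : b = i := by
      by_contra hbi
      refine depijA ⟨_, h1, insert_subset ?_ (insert_subset (mem_insert_self _ _) fun a ha => ?_)⟩
      · simp [Ne.symm hbi]
      · have : a ≠ b := fun h => hbA (h ▸ ha)
        simp [this, hAR₀ ha]
    rwa [hbi, erase_insert h₀.1.1] at h1
  · exfalso
    -- the first element of `A` making `i` dependent on the part of `A` up to it
    let G := A.filter fun m => ¬ Ind (insert i (A.filter (· ≤ m)))
    have hAne : A.Nonempty := by
      rw [nonempty_iff_ne_empty]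
      intro h
      rw [h] at indiA
      exact indiA indi
    have hGne : G.Nonempty := by
      refine ⟨A.max' hAne, mem_filter.mpr ⟨A.max'_mem hAne, ?_⟩⟩
      rwa [filter_true_of_mem fun e he => A.le_max' e he]
    let m := G.min' hGne
    obtain ⟨hmA, hmdep⟩ : m ∈ A ∧ ¬ Ind (insert i (A.filter (· ≤ m))) :=
      mem_filter.mp (G.min'_mem hGne)
    set L := A.filter (· < m) with hL
    have indiL : Ind (insert i L) := by
      by_contra h
      have hLne : L.Nonempty := by
        rw [nonempty_iff_ne_empty]
        intro h'
        rw [h'] at h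
        exact h indi
      have hm' := mem_filter.mp (L.max'_mem hLne)
      refine absurd (G.min'_le _ (mem_filter.mpr ⟨hm'.1, fun h2 => h (ind_mono ?_ h2)⟩))
        (not_le.mpr hm'.2)
      exact insert_subset_insert _ fun e he =>
        mem_filter.mpr ⟨(mem_filter.mp he).1, L.le_max' e he⟩
    have head_m : A.filter (· ≤ m) = insert m L := by
      ext e
      simp only [hL, mem_filter, mem_insert, le_iff_eq_or_lt, and_or_left]
      constructor
      · rintro (⟨_, h⟩ | h)
        exacts [Or.inl h, Or.inr h]
      · rintro (h | h)
        exacts [Or.inl ⟨h ▸ hmA, h⟩, Or.inr h]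
    rw [head_m] at hmdep
    obtain ⟨I, hI, hjAI⟩ := indjA
    have hjI : j ∈ I := hjAI (mem_insert_self j A)
    have hAI : A ⊆ I := (subset_insert j A).trans hjAI
    have hLI : L ⊆ I := (filter_subset _ _).trans hAI
    have hjm : j < m := (mem_filter.mp hmA).2
    have hiI : i ∉ I := fun h => indiA ⟨I, hI, insert_subset h hAI⟩
    have him : insert i (I.erase m) ∈ M := by
      obtain ⟨I', hI', hiLI'⟩ := indiL
      obtain ⟨b, hb, hbI', h1, -⟩ := hM I hI I' hI' i (hiLI' (mem_insert_self i L)) hiI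
      suffices b = m by rwa [this] at h1
      by_contra hbm
      refine hmdep ⟨_, h1, insert_subset_insert _ (insert_subset ?_ fun e he => ?_)⟩
      · exact mem_erase.mpr ⟨Ne.symm hbm, hAI hmA⟩
      · exact mem_erase.mpr ⟨fun h => hbI' (h ▸ hiLI' (mem_insert_of_mem he)), hLI he⟩
    have hij_dep : insert i (I.erase j) ∉ M := fun h => by
      refine hmdep ⟨_, h, insert_subset_insert _ (insert_subset ?_ fun e he => ?_)⟩
      · exact mem_erase.mpr ⟨hjm.ne', hAI hmA⟩
      · exact mem_erase.mpr ⟨fun h => hjA (h ▸ (mem_filter.mp he).1), hLI he⟩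
    obtain ⟨-, I', hI', hjI'⟩ := (mem_filter.mp hjE).2
    obtain ⟨b, hb, hbI, -, h2⟩ := hM I' hI' I hI j hjI hjI'
    have hbE : b ∈ E := memE hI' hb hI hbI
    have hbi : b < i := by
      refine lt_of_le_of_ne (not_lt.mp fun h => ?_) fun h => hij_dep (h ▸ h2)
      rcases (hjmin b hbE h).eq_or_lt with h' | h'
      · exact hbI (h' ▸ hjI)
      · exact hbI (hAI (mem_filter.mpr ⟨hbE, h'⟩))
    let N := (I.erase j).erase m
    have hmN : insert m N = I.erase j := insert_erase (mem_erase.mpr ⟨hjm.ne', hAI hmA⟩)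
    have hjN : insert j N = I.erase m := by
      rw [show N = (I.erase m).erase j from erase_right_comm]
      exact insert_erase (mem_erase.mpr ⟨hjm.ne, hjI⟩)
    have h3 := hp.three_term hbi hij hjm (L := N) (by simp [N, hbI]) (by simp [N, hiI])
      (by simp [N]) (by simp [N])
    rw [hmN, hjN, (hp.eq_zero_iff _).mpr hij_dep, mul_zero] at h3
    have := mul_pos ((hp.pos_iff _).mpr h2) ((hp.pos_iff _).mpr him)
    have := mul_nonneg (hp.nonneg (insert b (insert i N))) (hp.nonneg (insert j (insert m N)))
    rw [hmN] at this
    linarith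

theorem isPlucker_minor {C : Matrix (Fin k) (Fin n) ℝ} {M : Set (Finset (Fin n))}
    (h0 : ∀ S, 0 ≤ minor C S) (hpos : ∀ S, 0 < minor C S ↔ S ∈ M) : IsPlucker M (minor C) :=
  ⟨h0, hpos, minor_three_term C⟩

theorem exchange_of_isPlucker_minor {C : Matrix (Fin k) (Fin n) ℝ} {M : Set (Finset (Fin n))}
    (hC : IsPlucker M (minor C)) : Exchange M := by
  have hM : ∀ S, minor C S ≠ 0 ↔ S ∈ M := fun S => by simpa using (hC.eq_zero_iff S).not
  intro S hS S' hS' y hy hyS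
  simpa only [hM] using exists_exchange C ((hM S).mpr hS) ((hM S').mpr hS') hy hyS

/-- Add `t` times column `i` to column `j`. -/
def bridge (i j : Fin n) (t : ℝ) (C : Matrix (Fin k) (Fin n) ℝ) : Matrix (Fin k) (Fin n) ℝ :=
  C.updateCol j (C.col j + t • C.col i)

theorem bridge_bridge {i j : Fin n} (hij : i ≠ j) (s t : ℝ) (C : Matrix (Fin k) (Fin n) ℝ) :
    bridge i j s (bridge i j t C) = bridge i j (t + s) C := by
  ext a b
  by_cases hb : b = j
  · subst hb
    simp [bridge, Matrix.col, hij]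
    ring
  · simp [bridge, hb]

theorem bridge_zero (i j : Fin n) (C : Matrix (Fin k) (Fin n) ℝ) : bridge i j 0 C = C := by
  ext a b
  by_cases hb : b = j <;> simp [bridge, Matrix.col, hb]

theorem minor_bridge_of_notMem (C : Matrix (Fin k) (Fin n) ℝ) {i j : Fin n} (t : ℝ)
    {S : Finset (Fin n)} (hj : j ∉ S) : minor (bridge i j t C) S = minor C S :=
  minor_updateCol_of_notMem C hj _

theorem minor_bridge_of_mem (C : Matrix (Fin k) (Fin n) ℝ) {i j : Fin n} (t : ℝ)
    {S : Finset (Fin n)} (hj : j ∈ S) : minor (bridge i j t C) S =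
      minor C S + t * minor (C.updateCol j (C.col i)) S := by
  rw [bridge, ← minorCol_apply C hj, map_add, map_smul, minorCol_col_self C hj,
    minorCol_apply C hj, smul_eq_mul]

theorem minor_bridge_of_mem_of_mem (C : Matrix (Fin k) (Fin n) ℝ) {i j : Fin n} (hij : i ≠ j)
    (t : ℝ) {S : Finset (Fin n)} (hi : i ∈ S) (hj : j ∈ S) :
    minor (bridge i j t C) S = minor C S := by
  rw [minor_bridge_of_mem C t hj, minor_updateCol_col_of_mem C hj (mem_erase.mpr ⟨hij, hi⟩),
    mul_zero, add_zero]

/-- The sign of moving `i` to the position of `j` past the elements of `R`. -/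
def passSign (R : Finset (Fin n)) (i j : Fin n) : ℝ := insertSign R j * insertSign R i

theorem passSign_mul_self (R : Finset (Fin n)) (i j : Fin n) :
    passSign R i j * passSign R i j = 1 := by
  rw [passSign, mul_mul_mul_comm, insertSign_mul_self, insertSign_mul_self, one_mul]

theorem minor_bridge_insert (C : Matrix (Fin k) (Fin n) ℝ) {i j : Fin n} (t : ℝ)
    {R : Finset (Fin n)} (hi : i ∉ R) (hj : j ∉ R) : minor (bridge i j t C) (insert j R) =
      minor C (insert j R) + t * passSign R i j * minor C (insert i R) := by
  have he : (insert j R).erase j = R := erase_insert hj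
  rw [minor_bridge_of_mem C t (mem_insert_self j R),
    minor_updateCol_col C (mem_insert_self j R) (by rwa [he]), he, passSign]
  ring

theorem passSign_eq {i j : Fin n} {R : Finset (Fin n)} (hij : i < j) (hi : i ∉ R) :
    passSign R i j = (-1) ^ (R.filter fun e => i < e ∧ e < j).card := by
  have h : R.filter (· < j) = R.filter (· < i) ∪ R.filter fun e => i < e ∧ e < j := by
    ext e
    simp only [mem_filter, mem_union, ← and_or_left, and_congr_right_iff]
    intro he
    have : e ≠ i := fun h => hi (h ▸ he)
    constructor
    · intro h
      rcases lt_or_gt_of_ne this with h' | h'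
      exacts [Or.inl h', Or.inr ⟨h', h⟩]
    · rintro (h | h)
      exacts [h.trans hij, h.2]
  rw [passSign, insertSign, h, card_union_of_disjoint, pow_add, mul_right_comm]
  · change insertSign R i * insertSign R i * _ = _
    rw [insertSign_mul_self, one_mul]
  · rw [disjoint_filter]
    exact fun e _ h h' => h.not_gt h'.1

theorem Adjacent.passSign_eq_passSign {M : Set (Finset (Fin n))} {i j : Fin n}
    (hij : Adjacent M i j) {R R' : Finset (Fin n)} (hR : R ∈ link M i j) (hR' : R' ∈ link M i j) :
    passSign R i j = passSign R' i j := by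
  rw [passSign_eq hij.1 hR.1, passSign_eq hij.1 hR'.1]
  congr 2
  ext e
  simp only [mem_filter, and_congr_left_iff, and_imp]
  intro h1 h2
  constructor <;> intro he <;> by_contra he'
  · exact (hij.lt_of_lt hR hR' he he' h1).not_gt h2
  · exact (hij.lt_of_lt hR' hR he he' h1).not_gt h2

/-- The matrices with minors supported on `M` whose columns `I` form the identity matrix. -/
def slice (M : Set (Finset (Fin n))) (I : Finset (Fin n)) (hI : I.card = k) :
    Set (Matrix (Fin k) (Fin n) ℝ) :=
  {C | C.submatrix id (I.orderEmbOfFin hI) = 1 ∧ IsPlucker M (minor C)}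

theorem minor_of_mem_slice {M : Set (Finset (Fin n))} {I : Finset (Fin n)} {hI : I.card = k}
    {C : Matrix (Fin k) (Fin n) ℝ} (hC : C ∈ slice M I hI) : minor C I = 1 := by
  rw [minor_eq_pluck C I hI, pluck_eq_det, hC.1, Matrix.det_one]

theorem submatrix_bridge {I : Finset (Fin n)} (hI : I.card = k) {i j : Fin n} (hj : j ∉ I) (t : ℝ)
    (C : Matrix (Fin k) (Fin n) ℝ) : (bridge i j t C).submatrix id (I.orderEmbOfFin hI) =
      C.submatrix id (I.orderEmbOfFin hI) := by
  ext a b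
  have : I.orderEmbOfFin hI b ≠ j := fun h => hj (h ▸ I.orderEmbOfFin_mem hI b)
  simp [bridge, this]

/-- The support after removing the bridge at `i, j`: drop the sets where the ratio of minors
is minimal. -/
def facet (M : Set (Finset (Fin n))) (p : Finset (Fin n) → ℝ) (i j : Fin n)
    (R₀ : Finset (Fin n)) : Set (Finset (Fin n)) :=
  {S ∈ M | ∀ R, S = insert j R → R ∈ link M i j →
    p (insert i R₀) * p (insert j R) ≠ p (insert i R) * p (insert j R₀)}

/-- The pair `i < j` carries a bridge, whose weight is read off at `R₀`. -/
structure IsBridge (k : ℕ) (M : Set (Finset (Fin n))) (i j : Fin n) (R₀ : Finset (Fin n)) :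
    Prop where
  exchange : Exchange M
  card_eq : ∀ S ∈ M, S.card = k
  adjacent : Adjacent M i j
  first : IsFirst M i j R₀
  insert_mem : insert j R₀ ∈ M

theorem facet_subset (M : Set (Finset (Fin n))) (p : Finset (Fin n) → ℝ) (i j : Fin n)
    (R₀ : Finset (Fin n)) : facet M p i j R₀ ⊆ M := fun _ h => h.1

theorem mem_facet_iff_of_not {M : Set (Finset (Fin n))} {p : Finset (Fin n) → ℝ} {i j : Fin n}
    {R₀ S : Finset (Fin n)} (hS : j ∈ S → i ∈ S) (hij : i ≠ j) : S ∈ facet M p i j R₀ ↔ S ∈ M := by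
  refine ⟨fun h => h.1, fun h => ⟨h, ?_⟩⟩
  rintro R rfl hR
  have := hS (mem_insert_self j R)
  simp [hij, hR.1] at this

theorem exists_eq_insert {i j : Fin n} {S : Finset (Fin n)} (h : ¬ (j ∈ S → i ∈ S)) :
    ∃ R, S = insert j R ∧ i ∉ R ∧ j ∉ R := by
  simp only [Classical.not_imp] at h
  exact ⟨S.erase j, (insert_erase h.1).symm, by simp [h.2], by simp⟩

theorem insert_injective_of_notMem {j : Fin n} {R R' : Finset (Fin n)} (hj : j ∉ R) (hj' : j ∉ R')
    (h : insert j R = insert j R') : R = R' := by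
  rw [← erase_insert hj, h, erase_insert hj']

namespace IsBridge

variable {M : Set (Finset (Fin n))} {i j : Fin n} {R₀ : Finset (Fin n)}

theorem card_left (h : IsBridge k M i j R₀) : (insert i R₀).card = k :=
  h.card_eq _ h.first.1.2.2

theorem notMem_left (h : IsBridge k M i j R₀) : j ∉ insert i R₀ := by
  simp [h.adjacent.1.ne', h.first.1.2.1]

theorem exists_ratio_eq_iff (h : IsBridge k M i j R₀) {R : Finset (Fin n)} (hR : R ∈ link M i j) :
    ∃ Q : Prop, ∀ p, IsPlucker M p →
      p (insert i R) * p (insert j R₀) ≤ p (insert i R₀) * p (insert j R) ∧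
      (p (insert i R₀) * p (insert j R) = p (insert i R) * p (insert j R₀) ↔ Q) := by
  refine Positroid.exists_ratio_eq_iff h.exchange h.adjacent h.first R hR ?_
  have h1 := h.card_eq _ hR.2.2
  have h2 := h.card_left
  rw [card_insert_of_notMem hR.1] at h1
  rw [card_insert_of_notMem h.first.1.1] at h2
  omega

theorem insert_mem_of_link (h : IsBridge k M i j R₀) {p : Finset (Fin n) → ℝ}
    (hp : IsPlucker M p) {R : Finset (Fin n)} (hR : R ∈ link M i j) : insert j R ∈ M := by
  obtain ⟨Q, hQ⟩ := h.exists_ratio_eq_iff hR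
  have h1 := mul_pos ((hp.pos_iff _).mpr hR.2.2) ((hp.pos_iff _).mpr h.insert_mem)
  rw [← hp.pos_iff]
  exact pos_of_mul_pos_right (h1.trans_le (hQ p hp).1) (hp.nonneg _)

theorem mem_facet_iff (h : IsBridge k M i j R₀) {p q : Finset (Fin n) → ℝ}
    (hp : IsPlucker M p) (hq : IsPlucker M q) {R : Finset (Fin n)} (hR : R ∈ link M i j) :
    insert j R ∈ facet M p i j R₀ ↔
      q (insert i R) * q (insert j R₀) < q (insert i R₀) * q (insert j R) := by
  obtain ⟨Q, hQ⟩ := h.exists_ratio_eq_iff hR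
  rw [(hQ q hq).1.lt_iff_ne', Ne, (hQ q hq).2, ← (hQ p hp).2]
  constructor
  · exact fun hf => hf.2 R rfl hR
  · refine fun hne => ⟨h.insert_mem_of_link hp hR, fun R' hR' hl => ?_⟩
    rwa [← insert_injective_of_notMem hR.2.1 hl.2.1 hR']

theorem mem_facet_left (h : IsBridge k M i j R₀) (p : Finset (Fin n) → ℝ) :
    insert i R₀ ∈ facet M p i j R₀ :=
  (mem_facet_iff_of_not (fun _ => mem_insert_self i R₀) h.adjacent.1.ne).mpr h.first.1.2.2

theorem notMem_facet_right (h : IsBridge k M i j R₀) (p : Finset (Fin n) → ℝ) :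
    insert j R₀ ∉ facet M p i j R₀ :=
  fun hf => hf.2 R₀ rfl h.first.1 rfl

theorem remove_mem (h : IsBridge k M i j R₀) {p : Finset (Fin n) → ℝ} (hp : IsPlucker M p)
    {C : Matrix (Fin k) (Fin n) ℝ} (hC : C ∈ slice M (insert i R₀) h.card_left) :
    bridge i j (-(passSign R₀ i j * minor C (insert j R₀))) C ∈
      slice (facet M p i j R₀) (insert i R₀) h.card_left := by
  have hone := minor_of_mem_slice hC
  have key : ∀ S, 0 ≤ minor (bridge i j (-(passSign R₀ i j * minor C (insert j R₀))) C) S ∧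
      (0 < minor (bridge i j (-(passSign R₀ i j * minor C (insert j R₀))) C) S ↔
        S ∈ facet M p i j R₀) := by
    intro S
    by_cases hS : j ∈ S → i ∈ S
    · have : minor (bridge i j (-(passSign R₀ i j * minor C (insert j R₀))) C) S = minor C S := by
        by_cases hj : j ∈ S
        · exact minor_bridge_of_mem_of_mem C h.adjacent.1.ne _ (hS hj) hj
        · exact minor_bridge_of_notMem C _ hj
      rw [this, mem_facet_iff_of_not hS h.adjacent.1.ne]
      exact ⟨hC.2.nonneg S, hC.2.pos_iff S⟩
    · obtain ⟨R, rfl, hi, hj⟩ := exists_eq_insert hS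
      rw [minor_bridge_insert C _ hi hj]
      by_cases hR : insert i R ∈ M
      · have hl : R ∈ link M i j := ⟨hi, hj, hR⟩
        obtain ⟨Q, hQ⟩ := h.exists_ratio_eq_iff hl
        have hle := (hQ _ hC.2).1
        rw [h.mem_facet_iff hp hC.2 hl, h.adjacent.passSign_eq_passSign hl h.first.1]
        have hs := passSign_mul_self R₀ i j
        rw [hone, one_mul] at hle ⊢
        have : minor C (insert j R) + -(passSign R₀ i j * minor C (insert j R₀)) *
            passSign R₀ i j * minor C (insert i R) =
            minor C (insert j R) - minor C (insert i R) * minor C (insert j R₀) := by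
          linear_combination (-minor C (insert j R₀) * minor C (insert i R)) * hs
        rw [this, sub_nonneg, sub_pos]
        exact ⟨hle, Iff.rfl⟩
      · rw [(hC.2.eq_zero_iff _).mpr hR, mul_zero, add_zero, hC.2.pos_iff]
        refine ⟨hC.2.nonneg _, fun hm => ⟨hm, fun R' hR' hl => ?_⟩, fun hm => hm.1⟩
        rw [← insert_injective_of_notMem hj hl.2.1 hR'] at hl
        exact absurd hl.2.2 hR
  refine ⟨?_, isPlucker_minor (fun S => (key S).1) fun S => (key S).2⟩
  rw [submatrix_bridge _ h.notMem_left, hC.1]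

theorem add_mem (h : IsBridge k M i j R₀) {p : Finset (Fin n) → ℝ} (hp : IsPlucker M p)
    {C : Matrix (Fin k) (Fin n) ℝ}
    (hC : C ∈ slice (facet M p i j R₀) (insert i R₀) h.card_left) {t : ℝ} (ht : 0 < t) :
    bridge i j (passSign R₀ i j * t) C ∈ slice M (insert i R₀) h.card_left := by
  have key : ∀ S, 0 ≤ minor (bridge i j (passSign R₀ i j * t) C) S ∧
      (0 < minor (bridge i j (passSign R₀ i j * t) C) S ↔ S ∈ M) := by
    intro S
    by_cases hS : j ∈ S → i ∈ S
    · have : minor (bridge i j (passSign R₀ i j * t) C) S = minor C S := by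
        by_cases hj : j ∈ S
        · exact minor_bridge_of_mem_of_mem C h.adjacent.1.ne _ (hS hj) hj
        · exact minor_bridge_of_notMem C _ hj
      rw [this, ← mem_facet_iff_of_not (M := M) (p := p) (R₀ := R₀) hS h.adjacent.1.ne]
      exact ⟨hC.2.nonneg S, hC.2.pos_iff S⟩
    · obtain ⟨R, rfl, hi, hj⟩ := exists_eq_insert hS
      have hfi : insert i R ∈ facet M p i j R₀ ↔ insert i R ∈ M :=
        mem_facet_iff_of_not (fun _ => mem_insert_self i R) h.adjacent.1.ne
      rw [minor_bridge_insert C _ hi hj]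
      have hn := hC.2.nonneg (insert j R)
      by_cases hR : insert i R ∈ M
      · have hl : R ∈ link M i j := ⟨hi, hj, hR⟩
        have hpos := (hC.2.pos_iff _).mpr (hfi.mpr hR)
        have hs := passSign_mul_self R₀ i j
        rw [h.adjacent.passSign_eq_passSign hl h.first.1]
        have : minor C (insert j R) + passSign R₀ i j * t * passSign R₀ i j *
            minor C (insert i R) = minor C (insert j R) + t * minor C (insert i R) := by
          linear_combination (t * minor C (insert i R)) * hs
        rw [this]
        have hlt : 0 < minor C (insert j R) + t * minor C (insert i R) := by positivity
        exact ⟨hlt.le, fun _ => h.insert_mem_of_link hp hl, fun _ => hlt⟩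
      · rw [(hC.2.eq_zero_iff _).mpr (mt hfi.mp hR), mul_zero, add_zero, hC.2.pos_iff]
        refine ⟨hn, fun hm => hm.1, fun hm => ⟨hm, fun R' hR' hl => ?_⟩⟩
        rw [← insert_injective_of_notMem hj hl.2.1 hR'] at hl
        exact absurd hl.2.2 hR
  refine ⟨?_, isPlucker_minor (fun S => (key S).1) fun S => (key S).2⟩
  rw [submatrix_bridge _ h.notMem_left, hC.1]

theorem minor_add (h : IsBridge k M i j R₀) {p : Finset (Fin n) → ℝ}
    {C : Matrix (Fin k) (Fin n) ℝ}
    (hC : C ∈ slice (facet M p i j R₀) (insert i R₀) h.card_left) (t : ℝ) :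
    minor (bridge i j (passSign R₀ i j * t) C) (insert j R₀) = t := by
  rw [minor_bridge_insert C _ h.first.1.1 h.first.1.2.1, minor_of_mem_slice hC,
    (hC.2.eq_zero_iff _).mpr (h.notMem_facet_right p)]
  linear_combination t * passSign_mul_self R₀ i j

end IsBridge

theorem continuous_minor (S : Finset (Fin n)) :
    Continuous fun C : Matrix (Fin k) (Fin n) ℝ => minor C S := by
  by_cases h : S.card = k
  · simp only [minor_eq_pluck _ S h, pluck_eq_det]
    fun_prop
  · simp only [minor, dif_neg h]
    fun_prop

theorem continuous_bridge (i j : Fin n) :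
    Continuous fun x : ℝ × Matrix (Fin k) (Fin n) ℝ => bridge i j x.1 x.2 := by
  refine continuous_matrix fun a b => ?_
  by_cases hb : b = j
  · subst hb
    simp only [bridge, Matrix.updateCol_self, Pi.add_apply, Pi.smul_apply, Matrix.col_apply]
    fun_prop
  · simp only [bridge, Matrix.updateCol_ne hb]
    fun_prop

/-- Removing a bridge splits off a positive parameter. -/
def IsBridge.homeomorph {M : Set (Finset (Fin n))} {i j : Fin n} {R₀ : Finset (Fin n)}
    (h : IsBridge k M i j R₀) {p : Finset (Fin n) → ℝ} (hp : IsPlucker M p) :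
    slice M (insert i R₀) h.card_left ≃ₜ
      slice (facet M p i j R₀) (insert i R₀) h.card_left × Set.Ioi (0 : ℝ) where
  toFun C := (⟨_, h.remove_mem hp C.2⟩,
    ⟨minor C.1 (insert j R₀), (C.2.2.pos_iff _).mpr h.insert_mem⟩)
  invFun x := ⟨_, h.add_mem hp x.1.2 x.2.2⟩
  left_inv C := by
    apply Subtype.ext
    change bridge i j _ (bridge i j _ C.1) = C.1
    rw [bridge_bridge h.adjacent.1.ne, neg_add_cancel, bridge_zero]
  right_inv x := by
    apply Prod.ext <;> apply Subtype.ext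
    · change bridge i j _ (bridge i j _ x.1.1) = x.1.1
      rw [h.minor_add x.1.2, bridge_bridge h.adjacent.1.ne, add_neg_cancel, bridge_zero]
    · exact h.minor_add x.1.2 _
  continuous_toFun := by
    have hm : Continuous fun C : slice M (insert i R₀) h.card_left =>
        minor C.1 (insert j R₀) := (continuous_minor _).comp continuous_subtype_val
    refine Continuous.prodMk (Continuous.subtype_mk ?_ _) (hm.subtype_mk _)
    exact (continuous_bridge i j).comp
      ((continuous_const.mul hm).neg.prodMk continuous_subtype_val)
  continuous_invFun := by
    refine Continuous.subtype_mk ?_ _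
    exact (continuous_bridge i j).comp
      ((continuous_const.mul (continuous_subtype_val.comp continuous_snd)).prodMk
        (continuous_subtype_val.comp continuous_fst))

/-- A slice with a single nonvanishing minor is a point. -/
theorem slice_subsingleton {M : Set (Finset (Fin n))} {I : Finset (Fin n)} (hI : I.card = k)
    (hM : ∀ S ∈ M, S = I) : (slice M I hI).Subsingleton := by
  intro C hC D hD
  have hzero : ∀ C' ∈ slice M I hI, ∀ y ∉ I, C'.col y = 0 := by
    intro C' hC' y hy
    rw [← one_smul ℝ (C'.col y), ← minor_of_mem_slice hC', minor_smul_eq_sum C' I hI]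
    refine sum_eq_zero fun s hs => ?_
    have h0 : minor C' (insert y (I.erase s)) = 0 := by
      rw [hC'.2.eq_zero_iff]
      exact fun h => hy (hM _ h ▸ mem_insert_self _ _)
    rw [minorCol_apply C' hs, minor_updateCol_col C' hs (by simp [hy]), h0, mul_zero, zero_smul]
  ext a b
  by_cases hb : b ∈ I
  · obtain ⟨c, rfl⟩ : b ∈ Set.range (I.orderEmbOfFin hI) := by
      rw [range_orderEmbOfFin]; exact hb
    exact congrFun (congrFun (hC.1.trans hD.1.symm) a) c
  · exact (congrFun (hzero C hC b hb) a).trans (congrFun (hzero D hD b hb) a).symm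

theorem exists_eq_mul_of_span_eq {C D : Matrix (Fin k) (Fin n) ℝ}
    (hC : LinearIndependent ℝ fun i => C i)
    (h : Submodule.span ℝ (Set.range fun i => C i) = Submodule.span ℝ (Set.range fun i => D i)) :
    ∃ g : Matrix (Fin k) (Fin k) ℝ, IsUnit g.det ∧ D = g * C := by
  have key : ∀ {A B : Matrix (Fin k) (Fin n) ℝ},
      Submodule.span ℝ (Set.range fun i => A i) = Submodule.span ℝ (Set.range fun i => B i) →
      ∃ g : Matrix (Fin k) (Fin k) ℝ, B = g * A := by
    intro A B hAB
    have hB : ∀ i, ∃ c : Fin k → ℝ, ∑ j, c j • A j = B i := fun i => by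
      have hi : B i ∈ Submodule.span ℝ (Set.range fun i => A i) :=
        hAB ▸ Submodule.subset_span ⟨i, rfl⟩
      exact (Submodule.mem_span_range_iff_exists_fun ℝ).mp hi
    choose g hg using hB
    refine ⟨Matrix.of g, ?_⟩
    ext i b
    simp [Matrix.mul_apply, ← hg i]
  obtain ⟨g, hg⟩ := key h
  obtain ⟨g', hg'⟩ := key h.symm
  refine ⟨g, ?_, hg⟩
  have hinj : Function.Injective C.vecMul := Matrix.vecMul_injective_iff.mpr hC
  have h1 : g' * g = 1 := by
    have h2 : g' * g * C = C := by rw [Matrix.mul_assoc, ← hg, ← hg']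
    funext i
    apply hinj
    change Matrix.vecMul ((g' * g) i) C = Matrix.vecMul ((1 : Matrix _ _ ℝ) i) C
    rw [← Matrix.mul_apply_eq_vecMul, ← Matrix.mul_apply_eq_vecMul, Matrix.one_mul, h2]
  exact (Matrix.isUnit_iff_isUnit_det g).mp (IsUnit.of_mul_eq_one_right _ h1)

theorem span_mul_eq {g : Matrix (Fin k) (Fin k) ℝ} (hg : IsUnit g.det)
    (C : Matrix (Fin k) (Fin n) ℝ) : Submodule.span ℝ (Set.range fun i => (g * C) i) =
      Submodule.span ℝ (Set.range fun i => C i) := by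
  have key : ∀ (g : Matrix (Fin k) (Fin k) ℝ) (C : Matrix (Fin k) (Fin n) ℝ),
      Submodule.span ℝ (Set.range fun i => (g * C) i) ≤
        Submodule.span ℝ (Set.range fun i => C i) := by
    intro g C
    rw [Submodule.span_le]
    rintro _ ⟨i, rfl⟩
    rw [SetLike.mem_coe, Submodule.mem_span_range_iff_exists_fun]
    exact ⟨g i, by ext b; simp [Matrix.mul_apply]⟩
  refine le_antisymm (key g C) ?_
  have := key g⁻¹ (g * C)
  rwa [← Matrix.mul_assoc, Matrix.nonsing_inv_mul g hg, Matrix.one_mul] at this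

theorem linearIndependent_of_minor_ne_zero {C : Matrix (Fin k) (Fin n) ℝ} {I : Finset (Fin n)}
    (h : minor C I ≠ 0) : LinearIndependent ℝ fun i => C i := by
  have hI := card_of_minor_ne_zero h
  rw [minor_eq_pluck C I hI, pluck_eq_det] at h
  have h1 := Matrix.linearIndependent_rows_of_det_ne_zero h
  exact LinearIndependent.of_comp
    (LinearMap.funLeft ℝ ℝ (I.orderEmbOfFin hI)) h1

theorem isPlucker_minor_iff {M : Set (Finset (Fin n))} (hM : ∀ S ∈ M, S.card = k)
    (C : Matrix (Fin k) (Fin n) ℝ) : IsPlucker M (minor C) ↔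
      (∀ (S : Finset (Fin n)) (h : S.card = k), 0 ≤ pluck C S h) ∧
      (∀ (S : Finset (Fin n)) (h : S.card = k), (0 < pluck C S h ↔ S ∈ M)) := by
  constructor
  · intro h
    exact ⟨fun S hS => minor_eq_pluck C S hS ▸ h.nonneg S,
      fun S hS => minor_eq_pluck C S hS ▸ h.pos_iff S⟩
  · rintro ⟨h0, hpos⟩
    refine isPlucker_minor (fun S => ?_) (fun S => ?_) <;> by_cases hS : S.card = k
    · rw [minor_eq_pluck C S hS]; exact h0 S hS
    · rw [minor, dif_neg hS]
    · rw [minor_eq_pluck C S hS]; exact hpos S hS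
    · rw [minor, dif_neg hS]; exact iff_of_false (lt_irrefl _) (mt (hM S) hS)

theorem mem_SMset_iff {M : Set (Finset (Fin n))} (hM : ∀ S ∈ M, S.card = k) (P : Gr k n) :
    P ∈ SMset k n M ↔ ∃ (C : Matrix (Fin k) (Fin n) ℝ) (hC : LinearIndependent ℝ fun i => C i),
      grMk C hC = P ∧ IsPlucker M (minor C) := by
  simp only [isPlucker_minor_iff hM]; rfl

theorem IsPlucker.mul {M : Set (Finset (Fin n))} {C : Matrix (Fin k) (Fin n) ℝ}
    (hC : IsPlucker M (minor C)) {g : Matrix (Fin k) (Fin k) ℝ} (hg : 0 < g.det) :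
    IsPlucker M (minor (g * C)) :=
  isPlucker_minor (fun S => minor_mul g C S ▸ mul_nonneg hg.le (hC.nonneg S))
    fun S => by rw [minor_mul, mul_pos_iff_of_pos_left hg, hC.pos_iff]

/-- Row-reduce a matrix so that the columns `I` become the identity matrix. -/
def normalize (I : Finset (Fin n)) (hI : I.card = k) (C : Matrix (Fin k) (Fin n) ℝ) :
    Matrix (Fin k) (Fin n) ℝ :=
  (C.submatrix id (I.orderEmbOfFin hI))⁻¹ * C

theorem submatrix_mul_left (g : Matrix (Fin k) (Fin k) ℝ) (C : Matrix (Fin k) (Fin n) ℝ)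
    (f : Fin k → Fin n) : (g * C).submatrix id f = g * C.submatrix id f := rfl

theorem normalize_mul {I : Finset (Fin n)} (hI : I.card = k) {g : Matrix (Fin k) (Fin k) ℝ}
    (hg : IsUnit g.det) (C : Matrix (Fin k) (Fin n) ℝ) :
    normalize I hI (g * C) = normalize I hI C := by
  rw [normalize, submatrix_mul_left, Matrix.mul_inv_rev, Matrix.mul_assoc, ← Matrix.mul_assoc g⁻¹,
    Matrix.nonsing_inv_mul g hg, Matrix.one_mul, normalize]

theorem normalize_of_mem_slice {M : Set (Finset (Fin n))} {I : Finset (Fin n)} {hI : I.card = k}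
    {C : Matrix (Fin k) (Fin n) ℝ} (hC : C ∈ slice M I hI) : normalize I hI C = C := by
  rw [normalize, hC.1, inv_one, Matrix.one_mul]

theorem normalize_mem_slice {M : Set (Finset (Fin n))} {I : Finset (Fin n)} (hI : I.card = k)
    (hIM : I ∈ M) {C : Matrix (Fin k) (Fin n) ℝ} (hC : IsPlucker M (minor C)) :
    normalize I hI C ∈ slice M I hI := by
  have hpos := (hC.pos_iff I).mpr hIM
  rw [minor_eq_pluck C I hI, pluck_eq_det] at hpos
  constructor
  · rw [normalize, submatrix_mul_left, Matrix.nonsing_inv_mul _ hpos.ne'.isUnit]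
  · refine hC.mul ?_
    rw [Matrix.det_nonsing_inv, Ring.inverse_eq_inv']
    exact inv_pos.mpr hpos

/-- The reduced matrix representing a point of the Grassmannian. -/
def grNormalize (I : Finset (Fin n)) (hI : I.card = k) (P : Gr k n) : Matrix (Fin k) (Fin n) ℝ :=
  Quotient.lift (s := grSetoid k n) (fun C => normalize I hI C.1) (fun C D h => by
    obtain ⟨g, hg, hD⟩ := exists_eq_mul_of_span_eq C.2 h
    rw [hD, normalize_mul hI hg]) P

theorem grNormalize_grMk {I : Finset (Fin n)} (hI : I.card = k) {C : Matrix (Fin k) (Fin n) ℝ}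
    (hC : LinearIndependent ℝ fun i => C i) : grNormalize I hI (grMk C hC) = normalize I hI C :=
  rfl

/-- The points of the Grassmannian with nonvanishing Pluecker coordinate at `I`. -/
def chart (k : ℕ) (I : Finset (Fin n)) : Set (Gr k n) :=
  {P | ∃ (C : Matrix (Fin k) (Fin n) ℝ) (hC : LinearIndependent ℝ fun i => C i),
    grMk C hC = P ∧ minor C I ≠ 0}

theorem exists_mul_of_grMk_eq {C D : Matrix (Fin k) (Fin n) ℝ}
    {hC : LinearIndependent ℝ fun i => C i} {hD : LinearIndependent ℝ fun i => D i}
    (h : grMk C hC = grMk D hD) : ∃ g : Matrix (Fin k) (Fin k) ℝ, IsUnit g.det ∧ D = g * C :=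
  exists_eq_mul_of_span_eq hC (Quotient.exact h)

theorem grMk_mem_chart {I : Finset (Fin n)} {C : Matrix (Fin k) (Fin n) ℝ}
    {hC : LinearIndependent ℝ fun i => C i} : grMk C hC ∈ chart k I ↔ minor C I ≠ 0 := by
  constructor
  · rintro ⟨D, hD, h, hne⟩
    obtain ⟨g, -, rfl⟩ := exists_mul_of_grMk_eq h.symm
    rw [minor_mul] at hne
    exact right_ne_zero_of_mul hne
  · exact fun h => ⟨C, hC, rfl, h⟩

theorem isQuotientMap_grMk : Topology.IsQuotientMap
    (fun C : FullRk k n => (grMk C.1 C.2 : Gr k n)) :=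
  isQuotientMap_quot_mk

theorem continuous_val : Continuous fun C : FullRk k n => C.1 := continuous_subtype_val

theorem isOpen_chart (I : Finset (Fin n)) : IsOpen (chart k I) := by
  rw [← isQuotientMap_grMk.isOpen_preimage]
  have : (fun C : FullRk k n => (grMk C.1 C.2 : Gr k n)) ⁻¹' chart k I =
      {C | minor C.1 I ≠ 0} := Set.ext fun C => grMk_mem_chart
  rw [this]
  exact isOpen_ne_fun ((continuous_minor I).comp continuous_val) continuous_const

theorem continuousOn_grNormalize {I : Finset (Fin n)} (hI : I.card = k) :
    ContinuousOn (grNormalize I hI) (chart k I) := by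
  rw [isQuotientMap_grMk.continuousOn_isOpen_iff (isOpen_chart I)]
  intro C hC
  apply ContinuousAt.continuousWithinAt
  have hne : (C.1.submatrix id (I.orderEmbOfFin hI)).det ≠ 0 := by
    have := grMk_mem_chart.mp hC
    rwa [minor_eq_pluck _ I hI, pluck_eq_det] at this
  have hsub : Continuous fun C : FullRk k n => C.1.submatrix id (I.orderEmbOfFin hI) :=
    continuous_val.matrix_submatrix _ _
  have hinv : ContinuousAt
      (fun C : FullRk k n => (C.1.submatrix id (I.orderEmbOfFin hI))⁻¹) C := by
    refine ContinuousAt.comp (g := Inv.inv) (continuousAt_matrix_inv _ ?_) hsub.continuousAt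
    rw [Ring.inverse_eq_inv']
    exact continuousAt_inv₀ hne
  have hmul : Continuous fun x : Matrix (Fin k) (Fin k) ℝ × Matrix (Fin k) (Fin n) ℝ =>
      x.1 * x.2 := continuous_fst.matrix_mul continuous_snd
  exact ContinuousAt.comp
    (f := fun C : FullRk k n => ((C.1.submatrix id (I.orderEmbOfFin hI))⁻¹, C.1))
    hmul.continuousAt (hinv.prodMk continuous_val.continuousAt)

/-- A cell is homeomorphic to each of its slices. -/
def cellHomeomorphSlice {M : Set (Finset (Fin n))} (hM : ∀ S ∈ M, S.card = k)
    {I : Finset (Fin n)} (hIM : I ∈ M) : SMset k n M ≃ₜ slice M I (hM I hIM) where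
  toFun P := ⟨grNormalize I (hM I hIM) P.1, by
    obtain ⟨C, hC, hP, hpl⟩ := (mem_SMset_iff hM P.1).mp P.2
    rw [← hP, grNormalize_grMk]
    exact normalize_mem_slice _ hIM hpl⟩
  invFun C := ⟨grMk C.1 (linearIndependent_of_minor_ne_zero (I := I)
      (by rw [minor_of_mem_slice C.2]; exact one_ne_zero)),
    (mem_SMset_iff hM _).mpr ⟨C.1, _, rfl, C.2.2⟩⟩
  left_inv P := by
    apply Subtype.ext
    obtain ⟨C, hC, hP, hpl⟩ := (mem_SMset_iff hM P.1).mp P.2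
    have hpos := (hpl.pos_iff I).mpr hIM
    rw [minor_eq_pluck C I (hM I hIM), pluck_eq_det] at hpos
    simp only [← hP, grNormalize_grMk]
    exact Quotient.sound (span_mul_eq (Matrix.isUnit_nonsing_inv_det _ hpos.ne'.isUnit) C)
  right_inv C := by
    apply Subtype.ext
    exact normalize_of_mem_slice C.2
  continuous_toFun := by
    refine Continuous.subtype_mk ?_ _
    have h : SMset k n M ⊆ chart k I := by
      intro P hP
      obtain ⟨C, hC, hP, hpl⟩ := (mem_SMset_iff hM P).mp hP
      exact ⟨C, hC, hP, ((hpl.pos_iff I).mpr hIM).ne'⟩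
    exact ((continuousOn_grNormalize (hM I hIM)).mono h).domRestrict
  continuous_invFun := by
    refine Continuous.subtype_mk ?_ _
    have h : Continuous fun C : slice M I (hM I hIM) => (⟨C.1,
        linearIndependent_of_minor_ne_zero (I := I)
          (by rw [minor_of_mem_slice C.2]; exact one_ne_zero)⟩ : FullRk k n) :=
      Continuous.subtype_mk continuous_subtype_val _
    exact isQuotientMap_grMk.continuous.comp h

theorem exists_minor_ne_zero {C : Matrix (Fin k) (Fin n) ℝ}
    (hC : LinearIndependent ℝ fun i => C i) : ∃ S, minor C S ≠ 0 := by
  obtain ⟨κ, a, ha, hsp, hli⟩ := exists_linearIndependent' ℝ C.col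
  have := Finite.of_injective a ha
  have := Fintype.ofFinite κ
  have hκ : Fintype.card κ = k := by
    rw [← finrank_span_eq_card hli, hsp, ← Matrix.rank_eq_finrank_span_cols,
      LinearIndependent.rank_matrix hC, Fintype.card_fin]
  have hS : (univ.map ⟨a, ha⟩).card = k := by rw [card_map, card_univ, hκ]
  refine ⟨univ.map ⟨a, ha⟩, ?_⟩
  rw [minor_eq_pluck _ _ hS, pluck_eq_det]
  have he : ∀ t, ∃ x, a x = (univ.map ⟨a, ha⟩).orderEmbOfFin hS t := fun t => by
    obtain ⟨x, -, hx⟩ := mem_map.mp ((univ.map ⟨a, ha⟩).orderEmbOfFin_mem hS t)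
    exact ⟨x, hx⟩
  choose e he using he
  have hinj : Function.Injective e := fun s t hst =>
    ((univ.map ⟨a, ha⟩).orderEmbOfFin hS).injective (by rw [← he, ← he, hst])
  rw [← isUnit_iff_ne_zero, ← Matrix.isUnit_iff_isUnit_det,
    ← Matrix.linearIndependent_cols_iff_isUnit]
  have hcol : (C.submatrix id ((univ.map ⟨a, ha⟩).orderEmbOfFin hS)).col = (C.col ∘ a) ∘ e :=
    funext fun t => congrArg C.col (he t).symm
  rw [hcol]
  exact hli.comp e hinj

/-- A cell with at least two nonvanishing Pluecker coordinates is a smaller cell times a line. -/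
theorem exists_facet_homeomorph {M : Set (Finset (Fin n))} (hM : ∀ S ∈ M, S.card = k)
    {C : Matrix (Fin k) (Fin n) ℝ} (hC : IsPlucker M (minor C)) (hnt : M.Nontrivial) :
    ∃ M' ⊂ M, (SMset k n M').Nonempty ∧ Nonempty (SMset k n M ≃ₜ SMset k n M' × ℝ) := by
  obtain ⟨S₀, hS₀, S₁, hS₁, hne⟩ := hnt
  have hex := exchange_of_isPlucker_minor hC
  obtain ⟨i, j, R₀, hadj, hfirst, hmem⟩ := exists_bridge hex hC hM hS₀ hS₁ hne
  have hb : IsBridge k M i j R₀ := ⟨hex, hM, hadj, hfirst, hmem⟩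
  have hI : insert i R₀ ∈ M := hfirst.1.2.2
  have hsub := facet_subset M (minor C) i j R₀
  have hM' : ∀ S ∈ facet M (minor C) i j R₀, S.card = k := fun S hS => hM S (hsub hS)
  let φ := cellHomeomorphSlice hM' (hb.mem_facet_left (minor C))
  refine ⟨facet M (minor C) i j R₀,
    ⟨hsub, fun h => hb.notMem_facet_right (minor C) (h hmem)⟩, ?_, ?_⟩
  · exact ⟨_, (φ.symm ⟨_, hb.remove_mem hC (normalize_mem_slice hb.card_left hI hC)⟩).2⟩
  · exact ⟨(cellHomeomorphSlice hM hI).trans ((hb.homeomorph hC).trans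
      (φ.symm.prodCongr Real.expOrderIso.toHomeomorph.symm))⟩

theorem exists_homeomorph (M : Set (Finset (Fin n))) (hM : ∀ S ∈ M, S.card = k)
    (hne : (SMset k n M).Nonempty) : ∃ d : ℕ, Nonempty (SMset k n M ≃ₜ (Fin d → ℝ)) := by
  induction hm : M.ncard using Nat.strong_induction_on generalizing M with
  | _ m ih =>
    obtain ⟨P, hP⟩ := hne
    obtain ⟨C, hC, -, hpl⟩ := (mem_SMset_iff hM P).mp hP
    by_cases hnt : M.Nontrivial
    · obtain ⟨M', hss, hne', ⟨φ⟩⟩ := exists_facet_homeomorph hM hpl hnt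
      obtain ⟨d, ⟨ψ⟩⟩ := ih _ (hm ▸ Set.ncard_lt_ncard hss) M' (fun S hS => hM S (hss.1 hS))
        hne' rfl
      have e : ((Fin d → ℝ) × ℝ) ≃L[ℝ] (Fin (d + 1) → ℝ) :=
        ContinuousLinearEquiv.ofFinrankEq (by simp)
      exact ⟨d + 1, ⟨φ.trans ((ψ.prodCongr (Homeomorph.refl ℝ)).trans e.toHomeomorph)⟩⟩
    · obtain ⟨I, hI⟩ := exists_minor_ne_zero hC
      have hIM : I ∈ M := by_contra fun h => hI ((hpl.eq_zero_iff I).mpr h)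
      have hsub := slice_subsingleton (hM I hIM)
        fun S hS => Set.not_nontrivial_iff.mp hnt hS hIM
      have : Unique (slice M I (hM I hIM)) :=
        { default := ⟨_, normalize_mem_slice (hM I hIM) hIM hpl⟩
          uniq := fun D => Subtype.ext (hsub D.2 (normalize_mem_slice (hM I hIM) hIM hpl)) }
      exact ⟨0, ⟨(cellHomeomorphSlice hM hIM).trans (Homeomorph.homeomorphOfUnique _ _)⟩⟩

theorem eq_of_mem_SMset {M M' : Set (Finset (Fin n))} (hM : ∀ S ∈ M, S.card = k)
    (hM' : ∀ S ∈ M', S.card = k) {P : Gr k n} (h : P ∈ SMset k n M) (h' : P ∈ SMset k n M') :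
    M = M' := by
  obtain ⟨C, hC, hCP, hpl⟩ := (mem_SMset_iff hM P).mp h
  obtain ⟨D, hD, hDP, hpl'⟩ := (mem_SMset_iff hM' P).mp h'
  obtain ⟨g, hg, rfl⟩ := exists_mul_of_grMk_eq (hCP.trans hDP.symm)
  ext S
  rw [← not_iff_not, ← hpl.eq_zero_iff, ← hpl'.eq_zero_iff, minor_mul, mul_eq_zero,
    or_iff_right hg.ne_zero]

end Positroid

/-- Postnikov: the positroid decomposition of the totally nonnegative
Grassmannian is a decomposition into open cells: every nonempty `S_M` is
homeomorphic to some `ℝ^d`, the `S_M` cover the totally nonnegative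
Grassmannian, and they are pairwise disjoint. -/
theorem stmt2 (k n : ℕ) (hk : 0 < k) (hkn : k ≤ n) :
    (∀ M : Set (Finset (Fin n)), (∀ S ∈ M, S.card = k) → (SMset k n M).Nonempty →
      ∃ d : ℕ, Nonempty (↥(SMset k n M) ≃ₜ (Fin d → ℝ))) ∧
    ({P : Gr k n | ∃ (C : Matrix (Fin k) (Fin n) ℝ)
        (hC : LinearIndependent ℝ (fun i => C i)),
        grMk C hC = P ∧
        (∀ (S : Finset (Fin n)) (h : S.card = k), 0 ≤ pluck C S h)} =
      ⋃ M ∈ {M : Set (Finset (Fin n)) | ∀ S ∈ M, S.card = k}, SMset k n M) ∧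
    (∀ M M' : Set (Finset (Fin n)), (∀ S ∈ M, S.card = k) → (∀ S ∈ M', S.card = k) →
      M ≠ M' → SMset k n M ∩ SMset k n M' = ∅) := by
  refine ⟨Positroid.exists_homeomorph, ?_, ?_⟩
  · ext P
    simp only [Set.mem_ofPred_eq, Set.mem_iUnion]
    constructor
    · rintro ⟨C, hC, hP, h0⟩
      exact ⟨{S | ∃ h : S.card = k, 0 < pluck C S h}, fun S hS => hS.1, C, hC, hP, h0,
        fun S h => ⟨fun hpos => ⟨h, hpos⟩, fun hS => hS.2⟩⟩
    · rintro ⟨M, -, C, hC, hP, h0, -⟩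
      exact ⟨C, hC, hP, h0⟩
  · intro M M' hM hM' hne
    rw [← Set.disjoint_iff_inter_eq_empty, Set.disjoint_left]
    exact fun P h h' => hne (Positroid.eq_of_mem_SMset hM hM' h h')
end
end

section
/- Let k, m ≥ 0 with k + m ≤ n, let Z be a real n×(k+m) matrix all of whose (k+m)×(k+m) minors are positive, and let C be a k×n real matrix of rank k representing a point of Gr≥0_{k,n}. Then the k×(k+m) matrix CZ has rank k. Consequently the amplituhedron map Z̃ : Gr≥0_{k,n} → Gr_{k,k+m}, sending the row span of C to the row span of CZ, is well defined. -/
noncomputable section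

/-- All maximal (`p x p`) minors of the `n x p` matrix `Z` are positive. -/
def posMaxMinors {n p : ℕ} (Z : Matrix (Fin n) (Fin p) ℝ) : Prop :=
  ∀ (S : Finset (Fin n)) (h : S.card = p),
    0 < (Z.submatrix (fun t => ((S.orderIsoOfFin h) t).val) id).det
open Module in
/-- An alternating form on `Fin n → ℝ`, expanded over the maximal minors of its arguments
(a form of the Cauchy-Binet formula). -/
theorem AlternatingMap.eq_sum_det_mul {k n : ℕ} (g : (Fin n → ℝ) [⋀^Fin k]→ₗ[ℝ] ℝ)
    (C : Matrix (Fin k) (Fin n) ℝ) :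
    g C.row = ∑ s : Set.powersetCard (Fin n) k,
      (C.submatrix id (s.val.orderEmbOfFin s.prop)).det *
        g (fun i => Pi.single (s.val.orderEmbOfFin s.prop i) 1) := by
  have h := congrArg (exteriorPower.alternatingMapLinearEquiv g)
    (((Pi.basisFun ℝ (Fin n)).exteriorPower k).sum_repr (exteriorPower.ιMulti ℝ k C.row))
  rw [exteriorPower.alternatingMapLinearEquiv_apply_ιMulti] at h
  rw [← h, map_sum]
  refine Finset.sum_congr rfl fun s _ => ?_
  rw [map_smul, exteriorPower.basis_repr_apply, exteriorPower.basis_apply,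
    exteriorPower.ιMultiDual_apply_ιMulti, exteriorPower.ιMulti_family,
    exteriorPower.alternatingMapLinearEquiv_apply_ιMulti, smul_eq_mul]
  congr 2
  ext i
  simp [Set.powersetCard.ofFinEmbEquiv_symm_apply]

/-- The alternating form `g` is positive on increasing tuples of standard basis vectors. -/
def IsPositiveForm {p n : ℕ} (g : (Fin n → ℝ) [⋀^Fin p]→ₗ[ℝ] ℝ) : Prop :=
  ∀ s : Fin p ↪o Fin n, 0 < g (fun i => Pi.single (s i) 1)

/-- A strictly increasing tuple that is not onto skips a least element `q`; it takes the values
`0, …, q - 1` first, and inserting `q` right after them gives a strictly increasing tuple. -/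
theorem exists_least_gap {p n : ℕ} (hpn : p < n) (s : Fin p ↪o Fin n) :
    ∃ (q : Fin n) (r : Fin (p + 1)), (r : ℕ) = q ∧ (∀ j < q, ∃ i, s i = j) ∧
      StrictMono (r.insertNth q s : Fin (p + 1) → Fin n) := by
  have hex : ∃ q : Fin n, q ∉ Set.range s := by
    by_contra! h
    have := Fintype.card_le_of_surjective s h
    simp at this
    omega
  obtain ⟨q, hq, hmin⟩ :=
    WellFounded.has_min (wellFounded_lt (α := Fin n)) {q | q ∉ Set.range s} hex
  have hlow : ∀ j < q, ∃ i, s i = j := fun j hj => by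
    by_contra h
    exact hmin j h hj
  have hself : ∀ j : ℕ, ∀ (hj : j < q), ∃ hp : j < p, (s ⟨j, hp⟩ : ℕ) = j := by
    intro j
    induction j using Nat.strong_induction_on with
    | _ j ih =>
      intro hj
      obtain ⟨i, hi⟩ := hlow ⟨j, hj.trans q.2⟩ hj
      have hij : (i : ℕ) = j := by
        rcases lt_trichotomy (i : ℕ) j with h | h | h
        · obtain ⟨hp, h'⟩ := ih i h (h.trans hj)
          have := congrArg Fin.val hi
          simp at this
          simp at h'
          omega
        · exact h
        · have hp : j < p := h.trans i.2
          have hlt : s ⟨j, hp⟩ < s i := s.strictMono h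
          rw [hi] at hlt
          have hlt' : (s ⟨j, hp⟩ : ℕ) < j := hlt
          obtain ⟨hp', h'⟩ := ih _ hlt' (hlt'.trans hj)
          have h2 : s ⟨(s ⟨j, hp⟩ : ℕ), hp'⟩ = s ⟨j, hp⟩ := Fin.ext h'
          have := congrArg Fin.val (s.injective h2)
          simp at this
          omega
      subst hij
      exact ⟨i.2, by simpa using congrArg Fin.val hi⟩
  have hqp : (q : ℕ) ≤ p := by
    by_contra! h
    exact lt_irrefl _ (hself p h).choose
  refine ⟨q, ⟨q, Nat.lt_succ_of_le hqp⟩, rfl, hlow, ?_⟩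
  have hhigh : ∀ i : Fin p, (q : ℕ) ≤ i → q < s i := by
    intro i hi
    by_contra! h
    have hne : s i ≠ q := fun h' => hq ⟨i, h'⟩
    have hlt : s i < q := lt_of_le_of_ne h hne
    obtain ⟨hp, h'⟩ := hself _ hlt
    have := congrArg Fin.val (s.injective (Fin.ext h'))
    simp at this
    have : (s i : ℕ) < q := hlt
    omega
  have hlow' : ∀ i : Fin p, (i : ℕ) < q → s i < q := by
    intro i hi
    obtain ⟨_, h'⟩ := hself i hi
    exact Fin.lt_def.2 (by simp at h'; omega)
  intro a b hab
  induction a using Fin.succAboveCases (⟨q, Nat.lt_succ_of_le hqp⟩ : Fin (p + 1)) with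
  | x =>
    induction b using Fin.succAboveCases (⟨q, Nat.lt_succ_of_le hqp⟩ : Fin (p + 1)) with
    | x => exact absurd hab (lt_irrefl _)
    | p j =>
      rw [Fin.insertNth_apply_same, Fin.insertNth_apply_succAbove]
      exact hhigh j (Fin.lt_succAbove_iff_le_castSucc _ _ |>.1 hab)
  | p i =>
    induction b using Fin.succAboveCases (⟨q, Nat.lt_succ_of_le hqp⟩ : Fin (p + 1)) with
    | x =>
      rw [Fin.insertNth_apply_same, Fin.insertNth_apply_succAbove]
      exact hlow' i (Fin.succAbove_lt_iff_castSucc_lt _ _ |>.1 hab)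
    | p j =>
      rw [Fin.insertNth_apply_succAbove, Fin.insertNth_apply_succAbove]
      exact s.strictMono (Fin.succAbove_lt_succAbove_iff.1 hab)

open Filter Topology in
/-- A positive form remains positive after contraction with `∑ j, (-t) ^ j e_j` for small
`t > 0`. -/
theorem IsPositiveForm.exists_curryLeft {p n : ℕ} (hpn : p < n)
    {f : (Fin n → ℝ) [⋀^Fin (p + 1)]→ₗ[ℝ] ℝ} (hf : IsPositiveForm f) :
    ∃ a : Fin n → ℝ, IsPositiveForm (f.curryLeft a) := by
  suffices h : ∀ s : Fin p ↪o Fin n, ∀ᶠ t : ℝ in 𝓝[>] 0,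
      0 < f.curryLeft (fun j : Fin n => (-t) ^ (j : ℕ)) (fun i => Pi.single (s i) 1) by
    obtain ⟨t, ht⟩ := (eventually_all.2 h).exists
    exact ⟨_, ht⟩
  intro s
  obtain ⟨q, r, hrq, hlow, hmono⟩ := exists_least_gap hpn s
  set v : Fin p → Fin n → ℝ := fun i => Pi.single (s i) 1
  let c : Fin n → ℝ := fun j => f (Matrix.vecCons (Pi.single j 1) v)
  have hexpand : ∀ t : ℝ, f.curryLeft (fun j : Fin n => (-t) ^ (j : ℕ)) v =
      ∑ j : Fin n, (-t) ^ (j : ℕ) * c j := by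
    intro t
    let L : (Fin n → ℝ) →ₗ[ℝ] ℝ :=
      { toFun := fun x => f.curryLeft x v
        map_add' := by simp
        map_smul' := by simp }
    refine (L.pi_apply_eq_sum_univ _).trans (Finset.sum_congr rfl fun j _ => ?_)
    have hj : (fun i => if j = i then (1 : ℝ) else 0) = Pi.single j 1 := by
      ext i
      simp [Pi.single_apply, eq_comm]
    rw [hj, smul_eq_mul]
    rfl
  have hzero : ∀ j < q, c j = 0 := by
    intro j hj
    obtain ⟨i, rfl⟩ := hlow j hj
    exact f.map_eq_zero_of_eq _ (i := 0) (j := i.succ) (by simp [v]) (Fin.succ_ne_zero i).symm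
  have hlead : 0 < (-1) ^ (q : ℕ) * c q := by
    have h := hf (OrderEmbedding.ofStrictMono _ hmono)
    have hins : (fun i => Pi.single ((OrderEmbedding.ofStrictMono _ hmono) i) (1 : ℝ)) =
        (r.insertNth (Pi.single q 1) v : Fin (p + 1) → Fin n → ℝ) := by
      ext i : 1
      induction i using Fin.succAboveCases r <;> simp [v]
    rw [hins, AlternatingMap.map_insertNth, hrq] at h
    simpa [c] using h
  let G : ℝ → ℝ := fun t => ∑ j, if j < q then 0 else (-1) ^ (j : ℕ) * t ^ ((j : ℕ) - q) * c j
  have hG : Continuous G := by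
    refine continuous_finsetSum _ fun j _ => ?_
    split_ifs <;> fun_prop
  have hG0 : 0 < G 0 := by
    have : G 0 = (-1) ^ (q : ℕ) * c q := by
      refine (Finset.sum_eq_single q (fun j _ hj => ?_) (by simp)).trans (by simp)
      split_ifs with h
      · rfl
      · have : (j : ℕ) - q ≠ 0 := by
          have := Fin.val_ne_of_ne hj
          have : (q : ℕ) ≤ j := not_lt.1 h
          omega
        simp [this]
    rwa [this]
  filter_upwards [nhdsWithin_le_nhds (hG.continuousAt.eventually (lt_mem_nhds hG0)),
    self_mem_nhdsWithin] with t htG ht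
  have hfac : ∑ j : Fin n, (-t) ^ (j : ℕ) * c j = t ^ (q : ℕ) * G t := by
    rw [Finset.mul_sum]
    refine Finset.sum_congr rfl fun j _ => ?_
    split_ifs with h
    · simp [hzero j h]
    · rw [neg_pow, ← Nat.add_sub_of_le (not_lt.1 h : (q : ℕ) ≤ j), Nat.add_sub_cancel_left]
      ring
  rw [hexpand, hfac]
  exact mul_pos (pow_pos ht _) htG

/-- Some maximal minor of a matrix with linearly independent rows does not vanish. -/
theorem exists_pluck_ne_zero {k n : ℕ} {C : Matrix (Fin k) (Fin n) ℝ}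
    (hC : LinearIndependent ℝ C.row) : ∃ S h, pluck C S h ≠ 0 := by
  by_contra! h
  have hrank : C.rank = k := by simpa using hC.rank_matrix
  obtain ⟨B, hB⟩ : ∃ B : Matrix (Fin n) (Fin k) ℝ, C * B = 1 := by
    rw [← Matrix.mulVec_surjective_iff_exists_right_inverse]
    have : C.mulVecLin.range = ⊤ :=
      Submodule.eq_top_of_finrank_eq (by simpa [Matrix.rank] using hrank)
    exact LinearMap.range_eq_top.1 this
  have hdet := (Matrix.detRowAlternating.compLinearMap B.vecMulLinear).eq_sum_det_mul C
  rw [Finset.sum_eq_zero fun s _ => by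
    rw [show (C.submatrix id (s.val.orderEmbOfFin s.prop)).det = 0 from h s.val s.prop,
      zero_mul]] at hdet
  have : (Matrix.detRowAlternating.compLinearMap B.vecMulLinear) C.row = (C * B).det := rfl
  rw [this, hB, Matrix.det_one] at hdet
  exact one_ne_zero hdet

/-- The rows of a matrix representing a totally nonnegative point extend to a tuple on which a
given positive form does not vanish. -/
theorem IsPositiveForm.exists_extension_ne_zero {k m n : ℕ} (hkm : k + m ≤ n)
    {f : (Fin n → ℝ) [⋀^Fin (k + m)]→ₗ[ℝ] ℝ} (hf : IsPositiveForm f)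
    {C : Matrix (Fin k) (Fin n) ℝ} (hC : LinearIndependent ℝ C.row)
    {ε : ℝ} (hCnn : ∀ S h, 0 ≤ ε * pluck C S h) (hε : ε ≠ 0) :
    ∃ (x : Fin (k + m) → Fin n → ℝ) (e : Fin k ↪ Fin (k + m)), x ∘ e = C.row ∧ f x ≠ 0 := by
  induction m with
  | zero =>
    refine ⟨C.row, Function.Embedding.refl _, rfl, ?_⟩
    have hpos : 0 < ε * f C.row := by
      rw [AlternatingMap.eq_sum_det_mul f C, Finset.mul_sum]
      obtain ⟨S, h, hS⟩ := exists_pluck_ne_zero hC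
      refine Finset.sum_pos' (fun s _ => ?_) ⟨⟨S, h⟩, Finset.mem_univ _, ?_⟩
      · rw [← mul_assoc]
        exact mul_nonneg (hCnn s.val s.prop) (hf _).le
      · rw [← mul_assoc]
        exact mul_pos ((hCnn S h).lt_of_ne' (mul_ne_zero hε hS)) (hf _)
    exact right_ne_zero_of_mul hpos.ne'
  | succ m ih =>
    obtain ⟨a, ha⟩ := IsPositiveForm.exists_curryLeft (p := k + m) (by omega) hf
    obtain ⟨x, e, hx, hne⟩ := ih (by omega) ha
    exact ⟨Matrix.vecCons a x, e.trans (Fin.succEmb _), by rw [← hx]; rfl, hne⟩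

/-- If `Z` has positive maximal minors and `C` is a full-rank matrix
representing a totally nonnegative point, then `C * Z` has rank `k`;
consequently the amplituhedron map is well defined (on row spans). -/
theorem stmt3 (k m n : ℕ) (hkm : k + m ≤ n)
    (Z : Matrix (Fin n) (Fin (k + m)) ℝ) (hZ : posMaxMinors Z)
    (C : Matrix (Fin k) (Fin n) ℝ)
    (hC : LinearIndependent ℝ (fun i => C i))
    (hCnn : ∃ ε : ℝ, (ε = 1 ∨ ε = -1) ∧
      ∀ (S : Finset (Fin n)) (h : S.card = k), 0 ≤ ε * pluck C S h) :
    (C * Z).rank = k ∧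
    ∀ C' : Matrix (Fin k) (Fin n) ℝ,
      LinearIndependent ℝ (fun i => C' i) →
      (∃ ε : ℝ, (ε = 1 ∨ ε = -1) ∧
        ∀ (S : Finset (Fin n)) (h : S.card = k), 0 ≤ ε * pluck C' S h) →
      Submodule.span ℝ (Set.range (fun i => C i)) =
        Submodule.span ℝ (Set.range (fun i => C' i)) →
      Submodule.span ℝ (Set.range (fun i => (C * Z) i)) =
        Submodule.span ℝ (Set.range (fun i => (C' * Z) i)) := by
  constructor
  · obtain ⟨ε, hε, hnn⟩ := hCnn
    have hε0 : ε ≠ 0 := by rcases hε with rfl | rfl <;> norm_num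
    have hf : IsPositiveForm (Matrix.detRowAlternating.compLinearMap Z.vecMulLinear) := by
      intro s
      have hcard : (Finset.univ.map s.toEmbedding).card = k + m := by simp
      have hs : s = (Finset.univ.map s.toEmbedding).orderEmbOfFin hcard :=
        Finset.orderEmbOfFin_unique' _ (by simp)
      have h := hZ _ hcard
      simp only [Finset.coe_orderIsoOfFin_apply, ← hs] at h
      have hdet : Matrix.detRowAlternating.compLinearMap Z.vecMulLinear
          (fun i => Pi.single (s i) 1) = (Z.submatrix s id).det := by
        change Matrix.det _ = _
        congr 1
        ext i j
        simp
      rwa [hdet]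
    obtain ⟨x, e, hx, hne⟩ := hf.exists_extension_ne_zero hkm hC hnn hε0
    have hli : LinearIndependent ℝ fun i => Matrix.vecMul (x i) Z :=
      Matrix.linearIndependent_rows_of_det_ne_zero hne
    have hCZ : LinearIndependent ℝ (C * Z).row := by
      have h := hli.comp e e.injective
      convert h using 1
      ext i : 1
      exact congrArg (Matrix.vecMul · Z) (congrFun hx.symm i)
    simpa using hCZ.rank_matrix
  · intro C' _ _ hspan
    have hmap : ∀ D : Matrix (Fin k) (Fin n) ℝ,
        Submodule.span ℝ (Set.range fun i => (D * Z) i) =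
          (Submodule.span ℝ (Set.range fun i => D i)).map Z.vecMulLinear := by
      intro D
      rw [Submodule.map_span, ← Set.range_comp]
      rfl
    rw [hmap, hmap, hspan]
end
end
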